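/- arXiv:2010.07714 — 3 statements merged into one kernel-verified Lean document; each statement's English description precedes it below -/
import Mathlib

section
/- Let t ∈ (0,1). Then for Lebesgue-almost every x ∈ (0,1), lim_{m→∞} #{ 1 ≤ k ≤ m : a_k(x) ≥ m^t } / m^{1−t} = 1/log 2, where a_k(x) are the continued fraction coefficients of x. -/
open MeasureTheory Filter

namespace CFaux
noncomputable section
open ProbabilityTheory

def G (y : ℝ) : ℝ := Int.fract y⁻¹
def phi (k : ℕ) (x : ℝ) : ℝ := 1 / (k + 1 + x)
def p (k : ℕ) (x : ℝ) : ℝ := (1 + x) / ((k + 1 + x) * (k + 2 + x))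
def P (k : ℕ) (x : ℝ) : ℝ := (1 + x) / (k + 1 + x)
def w (x : ℝ) : ENNReal := ENNReal.ofReal (1 / (Real.log 2 * (1 + x)))
def mu : Measure ℝ := (volume.restrict (Set.Ioo (0:ℝ) 1)).withDensity w
def LE (f : ℝ → ENNReal) (x : ℝ) : ENNReal := ∑' k, ENNReal.ofReal (p k x) * f (phi k x)

lemma measG : Measurable G := by unfold G; fun_prop
lemma measphi (k) : Measurable (phi k) := by unfold phi; fun_prop
lemma measp (k) : Measurable (p k) := by unfold p; fun_prop
lemma measP (k) : Measurable (P k) := by unfold P; fun_prop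
lemma measw : Measurable w := by unfold w; fun_prop
lemma measLE {f : ℝ → ENNReal} (hf : Measurable f) : Measurable (LE f) := by
  unfold LE
  refine Measurable.tsum fun k => ?_
  exact (measp k).ennreal_ofReal.mul (hf.comp (measphi k))

lemma phi_mem {x : ℝ} (hx : x ∈ Set.Ioo (0:ℝ) 1) (k : ℕ) : phi k x ∈ Set.Ioo (0:ℝ) 1 := by
  have h0 := hx.1
  have hk : (0:ℝ) ≤ k := Nat.cast_nonneg k
  constructor
  · unfold phi; positivity
  · unfold phi; rw [div_lt_one (by positivity)]; linarith

lemma G_phi {x : ℝ} (hx : x ∈ Set.Ico (0:ℝ) 1) (k : ℕ) : G (phi k x) = x := by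
  unfold G phi
  rw [one_div, inv_inv]
  have : (k:ℝ) + 1 + x = ((k + 1 : ℕ) : ℝ) + x := by push_cast; ring
  rw [this, Int.fract_natCast_add]
  exact Int.fract_eq_self.2 ⟨hx.1, hx.2⟩

lemma union_phi : (⋃ k : ℕ, phi k '' Set.Ico 0 1) = Set.Ioc (0:ℝ) 1 := by
  ext z
  simp only [Set.mem_iUnion, Set.mem_image]
  constructor
  · rintro ⟨k, x, hx, rfl⟩
    have h0 := hx.1
    have hk : (0:ℝ) ≤ k := Nat.cast_nonneg k
    constructor
    · unfold phi; positivity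
    · unfold phi; rw [div_le_one (by positivity)]; linarith
  · rintro ⟨h0, h1⟩
    have h2 : 1 ≤ z⁻¹ := (one_le_inv₀ h0).2 h1
    have h3 : 1 ≤ ⌊z⁻¹⌋₊ := Nat.le_floor (by simpa using h2)
    refine ⟨⌊z⁻¹⌋₊ - 1, z⁻¹ - ⌊z⁻¹⌋₊, ⟨?_, ?_⟩, ?_⟩
    · linarith [Nat.floor_le (by linarith : 0 ≤ z⁻¹)]
    · linarith [Nat.lt_floor_add_one z⁻¹]
    · unfold phi
      rw [Nat.cast_sub h3]
      simp

lemma phi_inj (k : ℕ) : Set.InjOn (phi k) (Set.Ico 0 1) := by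
  intro x hx y hy h
  rw [← G_phi hx k, ← G_phi hy k, h]

lemma phi_disj : Pairwise (Function.onFun Disjoint fun k : ℕ => phi k '' Set.Ico 0 1) := by
  intro i j hij
  refine Set.disjoint_left.2 ?_
  rintro z ⟨x, hx, rfl⟩ ⟨y, hy, h⟩
  apply hij
  have hxy : y = x := by rw [← G_phi hx i, ← G_phi hy j, h]
  subst hxy
  unfold phi at h
  rw [one_div, one_div] at h
  have := inv_injective h
  have h3 : (j:ℝ) = i := by linarith
  exact_mod_cast h3.symm

lemma change (F : ℝ → ENNReal) (hF : Measurable F) :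
    ∫⁻ x in Set.Ioo 0 1, F x =
      ∫⁻ y in Set.Ioo 0 1, ∑' k : ℕ, ENNReal.ofReal (1 / (k + 1 + y)^2) * F (phi k y) := by
  have e1 : (volume.restrict (Set.Ioo (0:ℝ) 1)) = volume.restrict (Set.Ioc (0:ℝ) 1) :=
    Measure.restrict_congr_set Ioo_ae_eq_Ioc
  have e2 : (volume.restrict (Set.Ioo (0:ℝ) 1)) = volume.restrict (Set.Ico (0:ℝ) 1) :=
    Measure.restrict_congr_set Ioo_ae_eq_Ico
  have hder : ∀ k : ℕ, ∀ x ∈ Set.Ico (0:ℝ) 1,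
      HasDerivWithinAt (phi k) (-(1 / (k + 1 + x)^2)) (Set.Ico 0 1) x := by
    intro k x hx
    have h0 := hx.1
    have hne : (k:ℝ) + 1 + x ≠ 0 := by positivity
    have h1 : HasDerivAt (fun x : ℝ => (k:ℝ) + 1 + x) 1 x := (hasDerivAt_id x).const_add _
    have h2 := h1.inv hne
    have h3 : phi k = (fun x : ℝ => (k:ℝ) + 1 + x)⁻¹ := by
      ext y; simp [phi]
    rw [h3]
    rw [neg_div] at h2
    exact h2.hasDerivWithinAt
  have hms : ∀ k : ℕ, MeasurableSet (phi k '' Set.Ico 0 1) := fun k =>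
    measurableSet_Ico.image_of_measurable_injOn (measphi k) (phi_inj k)
  conv_lhs => rw [e1, ← union_phi]
  rw [lintegral_iUnion hms phi_disj, e2, lintegral_tsum]
  · congr 1
    ext k
    rw [lintegral_image_eq_lintegral_abs_deriv_mul measurableSet_Ico (hder k) (phi_inj k)]
    refine lintegral_congr fun y => ?_
    rw [abs_neg, abs_of_nonneg (by positivity)]
  · intro k
    refine Measurable.aemeasurable ?_
    refine Measurable.mul (by fun_prop) (hF.comp (measphi k))

lemma log2pos : 0 < Real.log 2 := Real.log_pos (by norm_num)

lemma lint_mu {f : ℝ → ENNReal} (hf : Measurable f) :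
    ∫⁻ x, f x ∂mu = ∫⁻ x in Set.Ioo 0 1, w x * f x := by
  unfold mu
  rw [lintegral_withDensity_eq_lintegral_mul _ measw hf]
  rfl

lemma dualE {f g : ℝ → ENNReal} (hf : Measurable f) (hg : Measurable g) :
    ∫⁻ x, f x * g (G x) ∂mu = ∫⁻ x, LE f x * g x ∂mu := by
  rw [lint_mu (f := fun x => f x * g (G x)) (hf.mul (hg.comp measG)),
    lint_mu (f := fun x => LE f x * g x) ((measLE hf).mul hg),
    change (fun x => w x * (f x * g (G x))) (measw.mul (hf.mul (hg.comp measG)))]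
  refine setLIntegral_congr_fun measurableSet_Ioo fun y hy => ?_
  unfold LE
  rw [← ENNReal.tsum_mul_right, ← ENNReal.tsum_mul_left]
  congr 1
  ext k
  rw [G_phi ⟨hy.1.le, hy.2⟩]
  have h0 := hy.1
  have hl := log2pos
  have : ENNReal.ofReal (1 / (k + 1 + y)^2) * w (phi k y) = w y * ENNReal.ofReal (p k y) := by
    unfold w phi p
    rw [← ENNReal.ofReal_mul (by positivity), ← ENNReal.ofReal_mul (by positivity)]
    congr 1
    field_simp
    ring
  calc _ = (ENNReal.ofReal (1 / (k + 1 + y)^2) * w (phi k y)) * (f (phi k y) * g y) := by ring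
    _ = _ := by rw [this]; ring

lemma p_eq {x : ℝ} (hx : 0 < x) (k : ℕ) : p k x = P k x - P (k+1) x := by
  unfold p P
  push_cast
  field_simp
  ring

lemma p_nonneg {x : ℝ} (hx : 0 < x) (k : ℕ) : 0 ≤ p k x := by unfold p; positivity
lemma P_nonneg {x : ℝ} (hx : 0 < x) (k : ℕ) : 0 ≤ P k x := by unfold P; positivity

lemma P_tend (x : ℝ) : Tendsto (fun k => P k x) atTop (nhds 0) := by
  unfold P
  refine Tendsto.div_atTop tendsto_const_nhds ?_
  exact tendsto_atTop_add_const_right _ _ (tendsto_atTop_add_const_right _ _ tendsto_natCast_atTop_atTop)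

lemma hasSum_tail {x : ℝ} (hx : 0 < x) (n : ℕ) : HasSum (fun k => p (k + n) x) (P n x) := by
  rw [hasSum_iff_tendsto_nat_of_nonneg (fun k => p_nonneg hx _)]
  have : ∀ m, ∑ k ∈ Finset.range m, p (k + n) x = P n x - P (m + n) x := by
    intro m
    induction m with
    | zero => simp
    | succ m ih => rw [Finset.sum_range_succ, ih, p_eq hx, show m + 1 + n = m + n + 1 by ring]; ring
  simp_rw [this]
  have := ((tendsto_add_atTop_iff_nat n).2 (P_tend x)).const_sub (P n x)
  simpa using this

lemma hasSum_p {x : ℝ} (hx : 0 < x) : HasSum (fun k => p k x) 1 := by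
  have := hasSum_tail hx 0
  have h2 : P 0 x = 1 := by
    unfold P; simp only [Nat.cast_zero, zero_add]; exact div_self (by positivity)
  simpa [h2] using this

lemma LE_one {x : ℝ} (hx : 0 < x) : LE (fun _ => 1) x = 1 := by
  unfold LE
  simp only [mul_one]
  rw [← ENNReal.ofReal_tsum_of_nonneg (p_nonneg hx) (hasSum_p hx).summable, (hasSum_p hx).tsum_eq]
  simp

def B (n : ℕ) : Set ℝ := {y | ((n + 1 : ℕ) : ℝ) ≤ y⁻¹}

lemma measB (n) : MeasurableSet (B n) := measurableSet_le measurable_const measurable_inv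

lemma LE_B (n : ℕ) {x : ℝ} (hx : x ∈ Set.Ioo (0:ℝ) 1) :
    LE ((B n).indicator 1) x = ENNReal.ofReal (P n x) := by
  have h0 := hx.1
  have e : ENNReal.ofReal (P n x) = ∑' k, ENNReal.ofReal (p (k + n) x) := by
    rw [← ENNReal.ofReal_tsum_of_nonneg (fun k => p_nonneg h0 _) (hasSum_tail h0 n).summable,
      (hasSum_tail h0 n).tsum_eq]
  have hin : ∀ k, phi (k + n) x ∈ B n := by
    intro k
    simp only [B, phi, Set.mem_ofPred_eq]
    push_cast
    rw [one_div, inv_inv]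
    have : (0:ℝ) ≤ k := Nat.cast_nonneg k
    linarith
  have hout : ∀ k, k < n → phi k x ∉ B n := by
    intro k hk
    simp only [B, phi, Set.mem_ofPred_eq]
    push_cast
    rw [one_div, inv_inv]
    have : (k:ℝ) + 1 ≤ n := by exact_mod_cast hk
    linarith [hx.2]
  rw [e]
  unfold LE
  rw [← Summable.sum_add_tsum_nat_add' (k := n) ENNReal.summable, Finset.sum_eq_zero, zero_add]
  · refine tsum_congr fun k => ?_
    rw [Set.indicator_of_mem (hin k), Pi.one_apply, mul_one]
  · intro k hk
    rw [Set.indicator_of_notMem (hout k (Finset.mem_range.1 hk)), mul_zero]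

lemma mu_ae : ∀ᵐ x ∂mu, x ∈ Set.Ioo (0:ℝ) 1 :=
  (withDensity_absolutelyContinuous _ _).ae_le (ae_restrict_mem measurableSet_Ioo)

lemma mu_univ : mu Set.univ = 1 := by
  have hl := log2pos
  rw [← lintegral_one, lint_mu measurable_const]
  simp only [mul_one]
  unfold w
  rw [← ofReal_integral_eq_lintegral_ofReal]
  · rw [← integral_Ioc_eq_integral_Ioo, ← intervalIntegral.integral_of_le (by norm_num)]
    have : ∫ x in (0:ℝ)..1, 1 / (Real.log 2 * (1 + x)) = 1 := by
      have h1 : ∀ x : ℝ, 1 / (Real.log 2 * (1 + x)) = (Real.log 2)⁻¹ * (1 + x)⁻¹ := by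
        intro x; rw [one_div, mul_inv]
      simp_rw [h1]
      rw [intervalIntegral.integral_const_mul, intervalIntegral.integral_comp_add_left (fun x => x⁻¹)]
      rw [integral_inv (by norm_num)]
      norm_num
    rw [this]; simp
  · refine IntegrableOn.mono_set (t := Set.Icc 0 1) ?_ Set.Ioo_subset_Icc_self
    apply ContinuousOn.integrableOn_Icc
    refine ContinuousOn.div continuousOn_const (by fun_prop) ?_
    intro x hx
    have := hx.1
    positivity
  · filter_upwards [ae_restrict_mem measurableSet_Ioo] with x hx
    have := hx.1
    simp only [Pi.zero_apply]
    positivity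

instance : IsProbabilityMeasure mu := ⟨mu_univ⟩

lemma mp_G : MeasurePreserving G mu mu := by
  refine ⟨measG, ?_⟩
  ext s hs
  rw [Measure.map_apply measG hs]
  have := dualE (f := fun _ => 1) (g := s.indicator 1) measurable_const (measurable_one.indicator hs)
  simp only [one_mul] at this
  have h2 : ∫⁻ x, LE (fun _ => 1) x * s.indicator 1 x ∂mu = ∫⁻ x, s.indicator 1 x ∂mu := by
    refine lintegral_congr_ae ?_
    filter_upwards [mu_ae] with x hx
    rw [LE_one hx.1, one_mul]
  rw [h2, lintegral_indicator_one hs] at this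
  rw [← this, ← lintegral_indicator_one (measG hs)]
  rfl

lemma mu_B (n : ℕ) : mu (B n) = ∫⁻ x in Set.Ioo 0 1, ENNReal.ofReal (1 / (Real.log 2 * (n + 1 + x))) := by
  have h := dualE (f := (B n).indicator 1) (g := 1) (measurable_one.indicator (measB n)) measurable_one
  simp only [Pi.one_apply, mul_one] at h
  rw [lintegral_indicator_one (measB n), lint_mu (measLE (measurable_one.indicator (measB n)))] at h
  rw [h]
  refine setLIntegral_congr_fun measurableSet_Ioo fun y hy => ?_
  have h0 := hy.1
  have hl := log2pos
  rw [LE_B n hy]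
  unfold w P
  rw [← ENNReal.ofReal_mul (by positivity)]
  congr 1
  field_simp

lemma q_le (n : ℕ) : mu.real (B n) ≤ 1 / (Real.log 2 * (n + 1)) := by
  have hl := log2pos
  refine ENNReal.toReal_le_of_le_ofReal (by positivity) ?_
  rw [mu_B]
  calc _ ≤ ∫⁻ x in Set.Ioo (0:ℝ) 1, ENNReal.ofReal (1 / (Real.log 2 * (n + 1))) := by
        refine setLIntegral_mono' measurableSet_Ioo fun x hx => ?_
        have := hx.1
        gcongr ENNReal.ofReal (1 / (Real.log 2 * ?_))
        linarith
    _ = _ := by simp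

lemma le_q (n : ℕ) : 1 / (Real.log 2 * (n + 2)) ≤ mu.real (B n) := by
  have hl := log2pos
  rw [measureReal_def, ← ENNReal.ofReal_le_iff_le_toReal (measure_ne_top _ _), mu_B]
  calc _ = ∫⁻ x in Set.Ioo (0:ℝ) 1, ENNReal.ofReal (1 / (Real.log 2 * (n + 2))) := by simp
    _ ≤ _ := by
        refine setLIntegral_mono' measurableSet_Ioo fun x hx => ?_
        have := hx.1
        have := hx.2
        gcongr ENNReal.ofReal (1 / (Real.log 2 * ?_))
        linarith

lemma T_bound {f : ℝ → ℝ} {K : ℝ} (hK : 0 ≤ K)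
    (hf : ∀ x ∈ Set.Ioo (0:ℝ) 1, ∀ y ∈ Set.Ioo (0:ℝ) 1, |f x - f y| ≤ K * |x - y|)
    {x y : ℝ} (hx : x ∈ Set.Ioo (0:ℝ) 1) (hy : y ∈ Set.Ioo (0:ℝ) 1) (n : ℕ) :
    |(∑ k ∈ Finset.range n, p k x * f (phi k x)) - (∑ k ∈ Finset.range n, p k y * f (phi k y))
      + (P n x - P n y) * f (phi n y)| ≤ K * |x - y| * (15 / 16 - 15 / 8 / ((n + 1) * (n + 2))) := by
  have hx0 := hx.1
  have hy0 := hy.1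
  induction n with
  | zero =>
    have h1 : P 0 x = 1 := by
      unfold P; simp only [Nat.cast_zero, zero_add]; exact div_self (by positivity)
    have h2 : P 0 y = 1 := by
      unfold P; simp only [Nat.cast_zero, zero_add]; exact div_self (by positivity)
    simp [h1, h2]
    norm_num
  | succ n ih =>
    have hn : (0:ℝ) ≤ n := Nat.cast_nonneg n
    have e : (∑ k ∈ Finset.range (n+1), p k x * f (phi k x)) - (∑ k ∈ Finset.range (n+1), p k y * f (phi k y))
      + (P (n+1) x - P (n+1) y) * f (phi (n+1) y)
      = ((∑ k ∈ Finset.range n, p k x * f (phi k x)) - (∑ k ∈ Finset.range n, p k y * f (phi k y))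
      + (P n x - P n y) * f (phi n y)) + (p n x * (f (phi n x) - f (phi n y))
        + (P (n+1) x - P (n+1) y) * (f (phi (n+1) y) - f (phi n y))) := by
      rw [Finset.sum_range_succ, Finset.sum_range_succ, p_eq hx0, p_eq hy0]
      ring
    have b1 : |p n x * (f (phi n x) - f (phi n y))| ≤ K * |x - y| * (2 / ((n+1)^2 * (n+2)^2)) := by
      rw [abs_mul, abs_of_nonneg (p_nonneg hx0 n)]
      have h1 := hf _ (phi_mem hx n) _ (phi_mem hy n)
      have h2 : |phi n x - phi n y| = |x - y| / ((n + 1 + x) * (n + 1 + y)) := by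
        have : phi n x - phi n y = (y - x) / ((n + 1 + x) * (n + 1 + y)) := by
          unfold phi; field_simp; ring
        rw [this, abs_div, abs_sub_comm, abs_of_pos (a := ((n:ℝ) + 1 + x) * (n + 1 + y)) (by positivity)]
      have h3 : p n x / ((n + 1 + x) * (n + 1 + y)) ≤ 2 / ((n+1)^2 * (n+2)^2) := by
        have h4 : (1 + x) / (n + 1 + x) ≤ 2 / (n + 2) := by
          rw [div_le_div_iff₀ (by positivity) (by positivity)]
          nlinarith [hx.2]
        have h5 : p n x / ((n + 1 + x) * (n + 1 + y)) =
            ((1 + x) / (n + 1 + x)) * (1 / ((n + 2 + x) * ((n + 1 + x) * (n + 1 + y)))) := by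
          unfold p; field_simp
        have h6 : 1 / (((n:ℝ) + 2 + x) * ((n + 1 + x) * (n + 1 + y))) ≤ 1 / ((n + 2) * ((n+1) * (n+1))) := by
          gcongr 1 / (?_ * (?_ * ?_)) <;> linarith
        rw [h5]
        calc _ ≤ (2 / ((n:ℝ) + 2)) * (1 / ((n + 2) * ((n+1) * (n+1)))) := by gcongr
          _ = _ := by field_simp
      calc _ ≤ p n x * (K * (|x - y| / ((n + 1 + x) * (n + 1 + y)))) := by
            rw [← h2]
            exact mul_le_mul_of_nonneg_left h1 (p_nonneg hx0 n)
        _ = K * |x - y| * (p n x / ((n + 1 + x) * (n + 1 + y))) := by ring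
        _ ≤ _ := by gcongr
    have b2 : |(P (n+1) x - P (n+1) y) * (f (phi (n+1) y) - f (phi n y))| ≤ K * |x - y| * (1 / (n+2)^3) := by
      rw [abs_mul]
      have h1 := hf _ (phi_mem hy (n+1)) _ (phi_mem hy n)
      have h2 : |phi (n+1) y - phi n y| ≤ 1 / ((n + 2) * (n + 1)) := by
        have : phi (n+1) y - phi n y = - (1 / ((n + 2 + y) * (n + 1 + y))) := by
          unfold phi; push_cast; field_simp; ring
        rw [this, abs_neg, abs_of_pos (by positivity)]
        gcongr 1 / (?_ * ?_) <;> linarith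
      have h3 : |P (n+1) x - P (n+1) y| ≤ |x - y| * ((n + 1) / ((n + 2) * (n+2))) := by
        have : P (n+1) x - P (n+1) y = (x - y) * ((n + 1) / ((n + 2 + x) * (n+2+y))) := by
          unfold P; push_cast; field_simp; ring
        rw [this, abs_mul, abs_of_pos (a := ((n:ℝ) + 1) / ((n + 2 + x) * (n+2+y))) (by positivity)]
        gcongr |x - y| * ((n + 1) / (?_ * ?_)) <;> linarith
      calc _ ≤ (|x - y| * ((n + 1) / ((n + 2) * (n+2)))) * (K * (1 / ((n + 2) * (n + 1)))) := by
            refine mul_le_mul h3 (h1.trans (by gcongr)) (abs_nonneg _) (by positivity)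
        _ = _ := by field_simp
    have b3 : 2 / (((n:ℝ)+1)^2 * (n+2)^2) + 1 / ((n:ℝ)+2)^3 ≤ 15 / 8 / ((n + 1) * (n + 2)) - 15 / 8 / ((n + 1 + 1) * (n + 1 + 2)) := by
      have : 15 / 8 / (((n:ℝ) + 1) * (n + 2)) - 15 / 8 / ((n + 1 + 1) * (n + 1 + 2)) = 15 / 4 / ((n+1)*(n+2)*(n+3)) := by
        field_simp; ring
      rw [this, div_add_div _ _ (by positivity) (by positivity), div_le_div_iff₀ (by positivity) (by positivity)]
      rw [← sub_nonneg]
      ring_nf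
      nlinarith [hn, pow_nonneg hn 2, pow_nonneg hn 3, pow_nonneg hn 4, pow_nonneg hn 5, pow_nonneg hn 6, pow_nonneg hn 7, pow_nonneg hn 8]
    rw [e]
    push_cast
    have hc : 0 ≤ K * |x - y| := by positivity
    calc _ ≤ _ := abs_add_le _ _
      _ ≤ _ := add_le_add ih ((abs_add_le _ _).trans (add_le_add b1 b2))
      _ ≤ _ := by nlinarith [mul_le_mul_of_nonneg_left b3 hc]

def Lf (f : ℝ → ℝ) (x : ℝ) : ℝ := (LE (fun y => ENNReal.ofReal (f y)) x).toReal

lemma f_bdd {f : ℝ → ℝ} {K : ℝ} (hK : 0 ≤ K)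
    (hf : ∀ x ∈ Set.Ioo (0:ℝ) 1, ∀ y ∈ Set.Ioo (0:ℝ) 1, |f x - f y| ≤ K * |x - y|)
    {x : ℝ} (hx : x ∈ Set.Ioo (0:ℝ) 1) : |f x| ≤ |f (1/2)| + K := by
  have h := hf x hx (1/2) ⟨by norm_num, by norm_num⟩
  have h2 : |x - 1/2| ≤ 1 := by rw [abs_le]; constructor <;> linarith [hx.1, hx.2]
  have h3 := abs_sub_abs_le_abs_sub (f x) (f (1/2))
  nlinarith

lemma summ {f : ℝ → ℝ} {K : ℝ} (hK : 0 ≤ K)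
    (hf : ∀ x ∈ Set.Ioo (0:ℝ) 1, ∀ y ∈ Set.Ioo (0:ℝ) 1, |f x - f y| ≤ K * |x - y|)
    {x : ℝ} (hx : x ∈ Set.Ioo (0:ℝ) 1) : Summable fun k => p k x * f (phi k x) := by
  refine Summable.of_norm_bounded (g := fun k => p k x * (|f (1/2)| + K)) ((hasSum_p hx.1).summable.mul_right _) ?_
  intro k
  rw [norm_mul, Real.norm_of_nonneg (p_nonneg hx.1 k)]
  exact mul_le_mul_of_nonneg_left (f_bdd hK hf (phi_mem hx k)) (p_nonneg hx.1 k)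

lemma LE_eq {f : ℝ → ℝ} {K : ℝ} (hK : 0 ≤ K) (h0 : ∀ x ∈ Set.Ioo (0:ℝ) 1, 0 ≤ f x)
    (hf : ∀ x ∈ Set.Ioo (0:ℝ) 1, ∀ y ∈ Set.Ioo (0:ℝ) 1, |f x - f y| ≤ K * |x - y|)
    {x : ℝ} (hx : x ∈ Set.Ioo (0:ℝ) 1) :
    LE (fun y => ENNReal.ofReal (f y)) x = ENNReal.ofReal (∑' k, p k x * f (phi k x)) := by
  rw [ENNReal.ofReal_tsum_of_nonneg (fun k => mul_nonneg (p_nonneg hx.1 k) (h0 _ (phi_mem hx k))) (summ hK hf hx)]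
  unfold LE
  refine tsum_congr fun k => ?_
  rw [ENNReal.ofReal_mul (p_nonneg hx.1 k)]

lemma Lf_eq {f : ℝ → ℝ} {K : ℝ} (hK : 0 ≤ K) (h0 : ∀ x ∈ Set.Ioo (0:ℝ) 1, 0 ≤ f x)
    (hf : ∀ x ∈ Set.Ioo (0:ℝ) 1, ∀ y ∈ Set.Ioo (0:ℝ) 1, |f x - f y| ≤ K * |x - y|)
    {x : ℝ} (hx : x ∈ Set.Ioo (0:ℝ) 1) :
    Lf f x = ∑' k, p k x * f (phi k x) := by
  unfold Lf
  rw [LE_eq hK h0 hf hx, ENNReal.toReal_ofReal]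
  exact tsum_nonneg (fun k => mul_nonneg (p_nonneg hx.1 k) (h0 _ (phi_mem hx k)))

lemma contr {f : ℝ → ℝ} {K : ℝ} (hK : 0 ≤ K) (h0 : ∀ x ∈ Set.Ioo (0:ℝ) 1, 0 ≤ f x)
    (hf : ∀ x ∈ Set.Ioo (0:ℝ) 1, ∀ y ∈ Set.Ioo (0:ℝ) 1, |f x - f y| ≤ K * |x - y|) :
    ∀ x ∈ Set.Ioo (0:ℝ) 1, ∀ y ∈ Set.Ioo (0:ℝ) 1, |Lf f x - Lf f y| ≤ (15/16 * K) * |x - y| := by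
  intro x hx y hy
  rw [Lf_eq hK h0 hf hx, Lf_eq hK h0 hf hy]
  have t1 := (summ hK hf hx).hasSum.tendsto_sum_nat
  have t2 := (summ hK hf hy).hasSum.tendsto_sum_nat
  have t3 : Tendsto (fun n => (P n x - P n y) * f (phi n y)) atTop (nhds 0) := by
    have h : Tendsto (fun n => P n x - P n y) atTop (nhds 0) := by
      simpa using (P_tend x).sub (P_tend y)
    refine h.zero_mul_isBoundedUnder_le ?_
    refine isBoundedUnder_of ⟨|f (1/2)| + K, fun n => ?_⟩
    exact f_bdd hK hf (phi_mem hy n)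
  have t4 := ((t1.sub t2).add t3).abs
  rw [add_zero] at t4
  refine le_of_tendsto' t4 fun n => ?_
  refine (T_bound hK hf hx hy n).trans ?_
  have : (0:ℝ) ≤ 15 / 8 / ((n + 1) * (n + 2)) := by positivity
  have hc : 0 ≤ K * |x - y| := by positivity
  nlinarith

lemma decay (n : ℕ) : ∀ (f : ℝ → ℝ) (K : ℝ), Measurable f → 0 ≤ K → (∀ x ∈ Set.Ioo (0:ℝ) 1, 0 ≤ f x) →
    (∀ x ∈ Set.Ioo (0:ℝ) 1, ∀ y ∈ Set.Ioo (0:ℝ) 1, |f x - f y| ≤ K * |x - y|) →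
    ∀ g : ℝ → ENNReal, Measurable g →
    ∫⁻ x, ENNReal.ofReal (f x) * g (G^[n] x) ∂mu ≤
      (∫⁻ x, ENNReal.ofReal (f x) ∂mu + ENNReal.ofReal ((15/16)^n * K)) * ∫⁻ x, g x ∂mu := by
  induction n with
  | zero =>
    intro f K hm hK h0 hf g hg
    simp only [Function.iterate_zero, id, pow_zero, one_mul]
    rw [← lintegral_const_mul _ hg]
    refine lintegral_mono_ae ?_
    filter_upwards [mu_ae] with x hx
    gcongr
    have : ∫⁻ y, ENNReal.ofReal (f x) ∂mu ≤ ∫⁻ y, (ENNReal.ofReal (f y) + ENNReal.ofReal K) ∂mu := by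
      refine lintegral_mono_ae ?_
      filter_upwards [mu_ae] with y hy
      rw [← ENNReal.ofReal_add (h0 y hy) hK]
      apply ENNReal.ofReal_le_ofReal
      have h1 := (abs_le.1 (hf x hx y hy)).2
      have h2 : |x - y| ≤ 1 := by rw [abs_le]; constructor <;> linarith [hx.1, hx.2, hy.1, hy.2]
      nlinarith
    rw [lintegral_add_right _ measurable_const] at this
    simpa using this
  | succ n ih =>
    intro f K hm hK h0 hf g hg
    have hGn : Measurable (G^[n]) := measG.iterate n
    have e1 : ∫⁻ x, ENNReal.ofReal (f x) * g (G^[n+1] x) ∂mu = ∫⁻ x, ENNReal.ofReal (Lf f x) * g (G^[n] x) ∂mu := by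
      have := dualE (f := fun x => ENNReal.ofReal (f x)) (g := fun x => g (G^[n] x)) hm.ennreal_ofReal (hg.comp hGn)
      simp only [Function.iterate_succ_apply]
      rw [this]
      refine lintegral_congr_ae ?_
      filter_upwards [mu_ae] with x hx
      rw [Lf_eq hK h0 hf hx, LE_eq hK h0 hf hx]
    have e2 : ∫⁻ x, ENNReal.ofReal (f x) ∂mu = ∫⁻ x, ENNReal.ofReal (Lf f x) ∂mu := by
      have := dualE (f := fun x => ENNReal.ofReal (f x)) (g := fun x => 1) hm.ennreal_ofReal measurable_const
      simp only [mul_one] at this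
      rw [this]
      refine lintegral_congr_ae ?_
      filter_upwards [mu_ae] with x hx
      rw [Lf_eq hK h0 hf hx, LE_eq hK h0 hf hx]
    rw [e1, e2]
    have := ih (Lf f) (15/16 * K) (measLE hm.ennreal_ofReal).ennreal_toReal (by positivity)
      (fun x _ => ENNReal.toReal_nonneg) (contr hK h0 hf) g hg
    rwa [show (15/16 : ℝ)^n * (15/16 * K) = (15/16)^(n+1) * K by ring] at this

lemma q_lower (N : ℕ) : 1 / (N + 1 : ℝ) ≤ 2 * mu.real (B N) := by
  have h := le_q N
  have hl := log2pos
  have hl1 : Real.log 2 ≤ 1 := by linarith [Real.log_two_lt_d9]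
  have hN : (0:ℝ) ≤ N := Nat.cast_nonneg N
  have : 1 / (N + 1 : ℝ) ≤ 2 * (1 / (Real.log 2 * (N + 2))) := by
    rw [mul_one_div, div_le_div_iff₀ (by positivity) (by positivity)]
    nlinarith
  linarith

lemma pair (N n : ℕ) : mu.real (B N ∩ G^[n+1] ⁻¹' (B N)) ≤
    mu.real (B N)^2 * (1 + 2 * (15/16)^n) := by
  have hGn : Measurable (G^[n]) := measG.iterate n
  have hP : ∀ x ∈ Set.Ioo (0:ℝ) 1, ∀ y ∈ Set.Ioo (0:ℝ) 1, |P N x - P N y| ≤ (1 / (N + 1)) * |x - y| := by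
    intro x hx y hy
    have hx0 := hx.1
    have hy0 := hy.1
    have : P N x - P N y = (x - y) * (N / ((N + 1 + x) * (N+1+y))) := by
      unfold P; field_simp; ring
    rw [this, abs_mul, abs_of_nonneg (a := (N:ℝ) / ((N + 1 + x) * (N+1+y))) (by positivity), mul_comm]
    gcongr ?_ * |x - y|
    rw [div_le_div_iff₀ (by positivity) (by positivity)]
    nlinarith [(Nat.cast_nonneg N : (0:ℝ) ≤ N), mul_pos hx0 hy0, mul_nonneg (Nat.cast_nonneg N : (0:ℝ) ≤ N) hx0.le, mul_nonneg (Nat.cast_nonneg N : (0:ℝ) ≤ N) hy0.le]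
  have hB1 : Measurable ((B N).indicator (1 : ℝ → ENNReal)) := measurable_one.indicator (measB N)
  have hd := decay n (P N) (1 / (N + 1)) (measP N) (by positivity) (fun x hx => P_nonneg hx.1 N) hP
    ((B N).indicator 1) hB1
  have hE : ∀ᵐ x ∂mu, LE ((B N).indicator 1) x = ENNReal.ofReal (P N x) := by
    filter_upwards [mu_ae] with x hx using LE_B N hx
  have e1 : ∫⁻ x, ENNReal.ofReal (P N x) ∂mu = mu (B N) := by
    have := dualE (f := (B N).indicator 1) (g := fun x => 1) hB1 measurable_const
    simp only [mul_one] at this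
    rw [lintegral_indicator_one (measB N)] at this
    rw [this]
    refine lintegral_congr_ae ?_
    filter_upwards [hE] with x hx using hx.symm
  have e2 : mu (B N ∩ G^[n+1] ⁻¹' (B N)) = ∫⁻ x, ENNReal.ofReal (P N x) * (B N).indicator 1 (G^[n] x) ∂mu := by
    have := dualE (f := (B N).indicator 1) (g := fun x => (B N).indicator 1 (G^[n] x)) hB1 (hB1.comp hGn)
    have h2 : ∫⁻ x, LE ((B N).indicator 1) x * (B N).indicator 1 (G^[n] x) ∂mu =
      ∫⁻ x, ENNReal.ofReal (P N x) * (B N).indicator 1 (G^[n] x) ∂mu := by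
      refine lintegral_congr_ae ?_
      filter_upwards [hE] with x hx
      rw [hx]
    rw [← h2, ← this, ← lintegral_indicator_one ((measB N).inter ((measG.iterate (n+1)) (measB N)))]
    refine lintegral_congr fun x => ?_
    rw [Set.inter_indicator_one]
    rfl
  rw [e1, ← e2, lintegral_indicator_one (measB N)] at hd
  have hr := ENNReal.toReal_mono (by finiteness) hd
  rw [ENNReal.toReal_mul, ENNReal.toReal_add (by finiteness) (by finiteness), ENNReal.toReal_ofReal (by positivity)] at hr
  simp only [← measureReal_def] at hr
  have hq := q_lower N
  have hq0 : 0 ≤ mu.real (B N) := measureReal_nonneg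
  refine hr.trans ?_
  calc _ ≤ (mu.real (B N) + (15/16)^n * (2 * mu.real (B N))) * mu.real (B N) := by gcongr
    _ = _ := by ring

def X (N i : ℕ) : ℝ → ℝ := (G^[i] ⁻¹' (B N)).indicator 1
def S (N m : ℕ) (x : ℝ) : ℝ := ∑ i ∈ Finset.range m, X N i x

lemma measPre (N i : ℕ) : MeasurableSet (G^[i] ⁻¹' (B N)) := (measG.iterate i) (measB N)
lemma measX (N i : ℕ) : Measurable (X N i) := measurable_one.indicator (measPre N i)
lemma memX (N i : ℕ) : MemLp (X N i) 2 mu := by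
  refine MemLp.of_bound (measX N i).aestronglyMeasurable 1 (ae_of_all _ fun x => ?_)
  unfold X
  by_cases h : x ∈ G^[i] ⁻¹' (B N)
  · rw [Set.indicator_of_mem h]; simp
  · rw [Set.indicator_of_notMem h]; simp

lemma intX (N i : ℕ) : ∫ x, X N i x ∂mu = mu.real (B N) := by
  unfold X
  rw [integral_indicator_one (measPre N i), measureReal_def, measureReal_def,
    (mp_G.iterate i).measure_preimage (measB N).nullMeasurableSet]

lemma intXX (N i d : ℕ) : ∫ x, (X N i * X N (i + d)) x ∂mu = mu.real (B N ∩ G^[d] ⁻¹' (B N)) := by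
  unfold X
  rw [← Set.inter_indicator_one, integral_indicator_one ((measPre N i).inter (measPre N _))]
  have : G^[i] ⁻¹' B N ∩ G^[i + d] ⁻¹' B N = G^[i] ⁻¹' (B N ∩ G^[d] ⁻¹' (B N)) := by
    ext x
    simp only [Set.mem_inter_iff, Set.mem_preimage]
    rw [add_comm i d, Function.iterate_add_apply]
  rw [this, measureReal_def, measureReal_def,
    (mp_G.iterate i).measure_preimage ((measB N).inter (measPre N d)).nullMeasurableSet]

lemma cov_le' (N i d : ℕ) : cov[X N i, X N (i+d); mu] ≤ 3 * mu.real (B N) * (15/16)^d := by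
  rw [covariance_eq_sub (memX N i) (memX N _), intXX, intX, intX]
  have hq0 : 0 ≤ mu.real (B N) := measureReal_nonneg
  have hq1 : mu.real (B N) ≤ 1 := measureReal_le_one
  cases d with
  | zero =>
    simp only [Function.iterate_zero, Set.preimage_id, Set.inter_self, pow_zero]
    nlinarith
  | succ n =>
    have := pair N n
    have h2 : (0:ℝ) < (15/16)^n := by positivity
    rw [pow_succ]
    have h3 : mu.real (B N) * (15/16)^n * mu.real (B N) ≤ mu.real (B N) * (15/16)^n * 1 := by gcongr
    have h4 : 0 ≤ mu.real (B N) * (15/16)^n := by positivity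
    nlinarith

lemma cov_le (N i j : ℕ) : cov[X N i, X N j; mu] ≤ 3 * mu.real (B N) * (15/16)^((i - j) + (j - i)) := by
  rcases le_total i j with h | h
  · obtain ⟨d, rfl⟩ := Nat.exists_eq_add_of_le h
    have := cov_le' N i d
    simpa using this
  · obtain ⟨d, rfl⟩ := Nat.exists_eq_add_of_le h
    have := cov_le' N j d
    rw [covariance_comm]
    simpa using this

lemma geo (m : ℕ) : ∑ i ∈ Finset.range m, (15/16 : ℝ)^i ≤ 16 := by
  rw [geom_sum_eq (by norm_num)]
  have : (0:ℝ) < (15/16)^m := by positivity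
  rw [div_le_iff_of_neg (by norm_num)]
  linarith

lemma geo2 (i m : ℕ) : ∑ j ∈ Finset.range m, (15/16 : ℝ)^((i - j) + (j - i)) ≤ 32 := by
  have h1 : ∑ j ∈ Finset.range m, (15/16 : ℝ)^((i - j) + (j - i)) ≤
      ∑ j ∈ Finset.range (i + m), (15/16 : ℝ)^((i - j) + (j - i)) := by
    refine Finset.sum_le_sum_of_subset_of_nonneg (by simp) fun _ _ _ => by positivity
  refine h1.trans ?_
  rw [Finset.sum_range_add]
  have e2 : ∑ j ∈ Finset.range m, (15/16 : ℝ)^((i - (i + j)) + (i + j - i)) = ∑ j ∈ Finset.range m, (15/16 : ℝ)^j := by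
    refine Finset.sum_congr rfl fun j _ => ?_
    congr 1; omega
  have e1 : ∑ j ∈ Finset.range i, (15/16 : ℝ)^((i - j) + (j - i)) ≤ ∑ j ∈ Finset.range i, (15/16 : ℝ)^j := by
    rw [← Finset.sum_range_reflect]
    refine Finset.sum_le_sum fun j hj => ?_
    have := Finset.mem_range.1 hj
    refine pow_le_pow_of_le_one (by norm_num) (by norm_num) ?_
    omega
  rw [e2]
  linarith [geo m, geo i]

lemma var_S (N m : ℕ) : Var[S N m; mu] ≤ 96 * (m * mu.real (B N)) := by
  unfold S
  rw [variance_fun_sum' (fun i _ => memX N i)]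
  have hq0 : 0 ≤ mu.real (B N) := measureReal_nonneg
  calc _ ≤ ∑ i ∈ Finset.range m, ∑ j ∈ Finset.range m, 3 * mu.real (B N) * (15/16)^((i - j) + (j - i)) :=
        Finset.sum_le_sum fun i _ => Finset.sum_le_sum fun j _ => cov_le N i j
    _ ≤ ∑ i ∈ Finset.range m, 3 * mu.real (B N) * 32 := by
        refine Finset.sum_le_sum fun i _ => ?_
        rw [← Finset.mul_sum]
        exact mul_le_mul_of_nonneg_left (geo2 i m) (by positivity)
    _ = _ := by simp; ring

lemma memS (N m : ℕ) : MemLp (S N m) 2 mu := by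
  unfold S
  exact memLp_finsetSum _ fun i _ => memX N i

lemma intS (N m : ℕ) : ∫ x, S N m x ∂mu = m * mu.real (B N) := by
  unfold S
  rw [integral_finsetSum _ fun i _ => (memX N i).integrable (by norm_num)]
  simp [intX]

lemma q_pos (N : ℕ) : 0 < mu.real (B N) := by
  have h := q_lower N
  have : (0:ℝ) < 1 / (N + 1) := by positivity
  linarith

lemma ev (N m : ℕ) (hm : 0 < m) :
    ∫⁻ x, ENNReal.ofReal ((S N m x / (m * mu.real (B N)) - 1)^2) ∂mu ≤ ENNReal.ofReal (192 * ((N + 1) / m)) := by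
  have hq := q_pos N
  have hm' : (0:ℝ) < m := by exact_mod_cast hm
  have hint : Integrable (fun x => (S N m x - m * mu.real (B N))^2) mu :=
    ((memS N m).sub (memLp_const _)).integrable_sq
  have e : ∀ x, (S N m x / (m * mu.real (B N)) - 1)^2 = (S N m x - m * mu.real (B N))^2 * ((m * mu.real (B N))^2)⁻¹ := by
    intro x; field_simp
  simp_rw [e]
  rw [← ofReal_integral_eq_lintegral_ofReal (hint.mul_const _) (ae_of_all _ fun x => by positivity)]
  apply ENNReal.ofReal_le_ofReal
  rw [integral_mul_const]
  have h1 := variance_eq_integral (μ := mu) (memS N m).aestronglyMeasurable.aemeasurable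
  rw [intS] at h1
  rw [← h1]
  have h2 := var_S N m
  calc _ ≤ 96 * (m * mu.real (B N)) * ((m * mu.real (B N))^2)⁻¹ := by gcongr
    _ = 96 * (1 / mu.real (B N)) / m := by field_simp
    _ ≤ 96 * (2 * (N + 1)) / m := by
      gcongr
      have h := q_lower N
      rw [div_le_iff₀ (by positivity)] at h ⊢
      linarith
    _ = _ := by ring

lemma ae_conv (N m : ℕ → ℕ) (hm : ∀ j, 0 < m j) (hs : Summable fun j => ((N j : ℝ) + 1) / m j) :
    ∀ᵐ x ∂mu, Tendsto (fun j => S (N j) (m j) x / (m j * mu.real (B (N j)))) atTop (nhds 1) := by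
  have hmeas : ∀ j, Measurable fun x => ENNReal.ofReal ((S (N j) (m j) x / (m j * mu.real (B (N j))) - 1)^2) := by
    intro j
    have : Measurable (S (N j) (m j)) := by
      unfold S
      exact Finset.measurable_fun_sum _ fun i _ => measX _ i
    fun_prop
  have hfin : ∫⁻ x, ∑' j, ENNReal.ofReal ((S (N j) (m j) x / (m j * mu.real (B (N j))) - 1)^2) ∂mu ≠ ⊤ := by
    rw [lintegral_tsum fun j => (hmeas j).aemeasurable]
    refine ne_top_of_le_ne_top ?_ (ENNReal.tsum_le_tsum fun j => ev (N j) (m j) (hm j))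
    exact (hs.mul_left 192).tsum_ofReal_ne_top
  have := ae_lt_top (Measurable.tsum hmeas) hfin
  filter_upwards [this] with x hx
  have h1 := ENNReal.tendsto_atTop_zero_of_tsum_ne_top hx.ne
  have h2 := (ENNReal.tendsto_toReal ENNReal.zero_ne_top).comp h1
  have h3 : Tendsto (fun j => (S (N j) (m j) x / (m j * mu.real (B (N j))) - 1)^2) atTop (nhds 0) := by
    refine (h2.congr fun j => ?_)
    simp only [Function.comp]
    rw [ENNReal.toReal_ofReal (by positivity)]
  have h4 := h3.sqrt
  rw [Real.sqrt_zero] at h4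
  simp_rw [Real.sqrt_sq_eq_abs] at h4
  have h5 := (tendsto_zero_iff_abs_tendsto_zero _).2 h4
  simpa using h5.add_const 1

lemma S_mono {N N' n n' : ℕ} (hN : N' ≤ N) (hn : n ≤ n') (x : ℝ) : S N n x ≤ S N' n' x := by
  unfold S
  have hX : ∀ N i, 0 ≤ X N i x := fun N i => Set.indicator_nonneg (fun _ _ => zero_le_one) x
  calc _ ≤ ∑ i ∈ Finset.range n, X N' i x := by
        refine Finset.sum_le_sum fun i _ => ?_
        unfold X
        refine Set.indicator_le_indicator_of_subset ?_ (fun _ => zero_le_one) x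
        refine Set.preimage_mono fun y hy => ?_
        simp only [B, Set.mem_ofPred_eq] at hy ⊢
        refine le_trans ?_ hy
        exact_mod_cast (by omega)
    _ ≤ _ := Finset.sum_le_sum_of_subset_of_nonneg (by simpa using hn) fun i _ _ => hX N' i

lemma ncard_eq {v : ℝ} (hv : 0 < v) (m : ℕ) (x : ℝ) :
    ({k : ℕ | 1 ≤ k ∧ k ≤ m ∧ v ≤ ((⌊(G^[k - 1] x)⁻¹⌋ : ℤ) : ℝ)}.ncard : ℝ) = S (⌈v⌉₊ - 1) m x := by
  classical
  have hc : 0 < ⌈v⌉₊ := Nat.ceil_pos.2 hv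
  have key : ∀ y : ℝ, v ≤ ((⌊y⁻¹⌋ : ℤ) : ℝ) ↔ y ∈ B (⌈v⌉₊ - 1) := by
    intro y
    simp only [B, Set.mem_ofPred_eq]
    rw [Nat.sub_add_cancel hc, ← Int.ceil_le, ← Int.natCast_ceil_eq_ceil hv.le, Int.le_floor]
    simp
  have hset : {k : ℕ | 1 ≤ k ∧ k ≤ m ∧ v ≤ ((⌊(G^[k - 1] x)⁻¹⌋ : ℤ) : ℝ)} =
      (((Finset.range m).filter fun i => G^[i] x ∈ B (⌈v⌉₊ - 1)).image (· + 1) : Finset ℕ) := by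
    ext k
    simp only [Set.mem_ofPred_eq, key, Finset.coe_image, Set.mem_image, Finset.mem_coe, Finset.mem_filter, Finset.mem_range]
    constructor
    · rintro ⟨h1, h2, h3⟩
      exact ⟨k - 1, ⟨by omega, h3⟩, by omega⟩
    · rintro ⟨i, ⟨h1, h2⟩, rfl⟩
      exact ⟨by omega, by omega, by simpa using h2⟩
  rw [hset, Set.ncard_coe_finset, Finset.card_image_of_injective _ (add_left_injective 1)]
  unfold S X
  rw [Finset.card_filter]
  push_cast
  refine Finset.sum_congr rfl fun i _ => ?_
  simp [Set.indicator_apply]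

lemma q_asymp : Tendsto (fun N : ℕ => mu.real (B N) * ((N:ℝ) + 1)) atTop (nhds (1 / Real.log 2)) := by
  have hl := log2pos
  have h1 : Tendsto (fun N : ℕ => 1 / Real.log 2 * (1 - 1 / ((N:ℝ) + 2))) atTop (nhds (1 / Real.log 2)) := by
    have : Tendsto (fun N : ℕ => 1 / ((N:ℝ) + 2)) atTop (nhds 0) :=
      tendsto_const_nhds.div_atTop (tendsto_atTop_add_const_right _ _ tendsto_natCast_atTop_atTop)
    simpa using (this.const_sub 1).const_mul (1 / Real.log 2)
  refine tendsto_of_tendsto_of_tendsto_of_le_of_le h1 tendsto_const_nhds (fun N => ?_) (fun N => ?_)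
  · have := mul_le_mul_of_nonneg_right (le_q N) (by positivity : (0:ℝ) ≤ N + 1)
    refine le_trans (le_of_eq ?_) this
    field_simp
    ring
  · have := mul_le_mul_of_nonneg_right (q_le N) (by positivity : (0:ℝ) ≤ N + 1)
    refine le_trans this (le_of_eq ?_)
    field_simp

def M (K j : ℕ) : ℕ := (j + 1) ^ K
def u (t : ℝ) (K j : ℕ) : ℕ := ⌈((M K j : ℕ) : ℝ) ^ t⌉₊

lemma M_pos (K j : ℕ) : 0 < M K j := by unfold M; positivity
lemma u_pos (t : ℝ) (K j : ℕ) : 0 < u t K j := by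
  have : (0:ℝ) < M K j := by exact_mod_cast M_pos K j
  exact Nat.ceil_pos.2 (by positivity)
lemma u_cast (t : ℝ) (K j : ℕ) : ((u t K j - 1 : ℕ) : ℝ) + 1 = u t K j := by
  rw [Nat.cast_sub (u_pos t K j)]; simp
lemma M_mono (K : ℕ) : Monotone (M K) := fun i j h => by unfold M; gcongr
lemma u_mono {t : ℝ} (ht : 0 < t) (K : ℕ) : Monotone (u t K) := fun i j h => by
  unfold u; gcongr; exact M_mono K h

lemma summ_u {t : ℝ} (ht : t ∈ Set.Ioo (0:ℝ) 1) {K : ℕ} (hK : 2 ≤ K * (1 - t)) :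
    Summable fun j => (u t K (j+1) : ℝ) / M K j := by
  have hs : Summable fun j : ℕ => (2 * 2 ^ K : ℝ) * (1 / ((j + 1 : ℕ) : ℝ)^2) :=
    ((summable_nat_add_iff 1).2 (Real.summable_one_div_nat_pow.2 (by norm_num : 1 < 2))).mul_left _
  refine Summable.of_nonneg_of_le (fun j => by positivity) (fun j => ?_) hs
  have hj : (1:ℝ) ≤ ((j+1 : ℕ) : ℝ) := by exact_mod_cast (by omega)
  have hMpos : (0:ℝ) < M K j := by exact_mod_cast M_pos K j
  have hM1 : (1:ℝ) ≤ M K j := by exact_mod_cast M_pos K j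
  have hM2 : (1:ℝ) ≤ M K (j+1) := by exact_mod_cast M_pos K (j+1)
  have h1 : (u t K (j+1) : ℝ) ≤ 2 * (M K (j+1) : ℝ)^t := by
    have := (Nat.ceil_lt_add_one (a := (M K (j+1) : ℝ)^t) (by positivity)).le
    have h2 := Real.one_le_rpow hM2 ht.1.le
    unfold u; linarith
  have h3 : (M K (j+1) : ℝ)^t ≤ 2^K * (M K j : ℝ)^t := by
    have : (M K (j+1) : ℝ) ≤ 2^K * M K j := by
      have : M K (j+1) ≤ 2^K * M K j := by
        unfold M; rw [← mul_pow]; gcongr; omega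
      exact_mod_cast this
    calc _ ≤ ((2:ℝ)^K * M K j)^t := by gcongr; exact ht.1.le
      _ = ((2:ℝ)^K)^t * (M K j : ℝ)^t := Real.mul_rpow (by positivity) (by positivity)
      _ ≤ _ := by
        gcongr
        exact Real.rpow_le_self_of_one_le (one_le_pow₀ (by norm_num)) ht.2.le
  have h4 : (M K j : ℝ)^t / M K j ≤ 1 / ((j + 1 : ℕ) : ℝ)^2 := by
    have e : (M K j : ℝ)^t / M K j = 1 / (M K j : ℝ)^(1-t) := by
      rw [Real.rpow_sub hMpos, Real.rpow_one, one_div_div]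
    rw [e]
    gcongr
    unfold M
    push_cast
    rw [← Real.rpow_natCast _ K, ← Real.rpow_mul (by positivity), ← Real.rpow_natCast _ 2]
    refine Real.rpow_le_rpow_of_exponent_le (by exact_mod_cast hj) (by exact_mod_cast hK)
  calc _ ≤ 2 * (2^K * (M K j : ℝ)^t) / M K j := by gcongr; linarith
    _ = 2 * 2^K * ((M K j : ℝ)^t / M K j) := by ring
    _ ≤ _ := by gcongr

lemma M_ratio (K : ℕ) : Tendsto (fun j => (M K (j+1) : ℝ) / M K j) atTop (nhds 1) := by
  have h : Tendsto (fun j : ℕ => (1 + 1 / ((j:ℝ) + 1))^K) atTop (nhds 1) := by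
    have := ((tendsto_one_div_add_atTop_nhds_zero_nat (𝕜 := ℝ)).const_add 1).pow K
    simpa using this
  refine h.congr fun j => ?_
  unfold M
  push_cast
  rw [← div_pow]
  congr 1
  field_simp

lemma M_tend {K : ℕ} (hK : K ≠ 0) : Tendsto (fun j => (M K j : ℝ)) atTop atTop := by
  have h : Tendsto (fun j : ℕ => ((j + 1 : ℕ) : ℝ)) atTop atTop :=
    tendsto_natCast_atTop_atTop.comp (tendsto_add_atTop_nat 1)
  refine ((tendsto_pow_atTop hK).comp h).congr fun j => ?_
  simp [M]

lemma u_ratio {t : ℝ} (ht : 0 < t) {K : ℕ} (hK : K ≠ 0) :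
    Tendsto (fun j => (M K j : ℝ)^t / u t K j) atTop (nhds 1) := by
  have h := (tendsto_nat_ceil_div_atTop (R := ℝ)).comp ((tendsto_rpow_atTop ht).comp (M_tend hK))
  have h2 := h.inv₀ one_ne_zero
  rw [inv_one] at h2
  refine h2.congr fun j => ?_
  simp [u]

lemma u_tend {t : ℝ} (ht : 0 < t) {K : ℕ} (hK : K ≠ 0) : Tendsto (fun j => u t K j - 1) atTop atTop := by
  have h := (tendsto_nat_ceil_atTop (α := ℝ)).comp ((tendsto_rpow_atTop ht).comp (M_tend hK))
  exact (tendsto_sub_atTop_nat 1).comp h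

lemma main (t : ℝ) (ht : t ∈ Set.Ioo (0 : ℝ) 1) :
    ∀ᵐ x ∂mu, Tendsto (fun m : ℕ => S (⌈(m:ℝ)^t⌉₊ - 1) m x / (m : ℝ) ^ (1 - t))
        atTop (nhds (1 / Real.log 2)) := by
  have ht0 := ht.1
  have ht1 := ht.2
  obtain ⟨K, hK⟩ : ∃ K : ℕ, 2 ≤ (K:ℝ) * (1 - t) := by
    obtain ⟨K, hK⟩ := exists_nat_ge (2 / (1 - t))
    exact ⟨K, (div_le_iff₀ (by linarith)).1 hK⟩
  have hK0 : K ≠ 0 := by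
    rintro rfl
    norm_num at hK
  have hMpos : ∀ j, (0:ℝ) < M K j := fun j => by exact_mod_cast M_pos K j
  have hupos : ∀ j, (0:ℝ) < u t K j := fun j => by exact_mod_cast u_pos t K j
  have sU : Summable fun j => (((u t K j - 1 : ℕ) : ℝ) + 1) / M K (j+1) := by
    refine Summable.of_nonneg_of_le (fun j => by positivity) (fun j => ?_) (summ_u ht hK)
    rw [u_cast]
    have h1 : (u t K j : ℝ) ≤ u t K (j+1) := by exact_mod_cast u_mono ht0 K (Nat.le_succ j)
    have h2 : (M K j : ℝ) ≤ M K (j+1) := by exact_mod_cast M_mono K (Nat.le_succ j)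
    have := hMpos j
    gcongr
  have sV : Summable fun j => (((u t K (j+1) - 1 : ℕ) : ℝ) + 1) / M K j := by
    simp_rw [u_cast]
    exact summ_u ht hK
  have aU := ae_conv (fun j => u t K j - 1) (fun j => M K (j+1)) (fun j => M_pos K _) sU
  have aV := ae_conv (fun j => u t K (j+1) - 1) (fun j => M K j) (fun j => M_pos K _) sV
  filter_upwards [aU, aV] with x hU hV
  have hq := q_asymp.comp (u_tend ht0 hK0)
  have hq' : Tendsto (fun j => mu.real (B (u t K j - 1)) * u t K j) atTop (nhds (1 / Real.log 2)) := by
    refine hq.congr fun j => ?_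
    simp only [Function.comp]
    rw [u_cast]
  have hsplit : ∀ j, (M K j : ℝ)^(1 - t) = M K j / (M K j : ℝ)^t := fun j => by
    rw [Real.rpow_sub (hMpos j), Real.rpow_one]
  have cU : Tendsto (fun j => S (u t K j - 1) (M K (j+1)) x / (M K j : ℝ)^(1-t)) atTop (nhds (1 / Real.log 2)) := by
    have := ((hU.mul hq').mul (M_ratio K)).mul (u_ratio ht0 hK0)
    simp only [one_mul, mul_one] at this
    refine this.congr fun j => ?_
    rw [hsplit]
    have := hMpos j
    have := hMpos (j+1)
    have := hupos j
    have := q_pos (u t K j - 1)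
    have : 0 < (M K j : ℝ)^t := by positivity
    field_simp
  have cV : Tendsto (fun j => S (u t K (j+1) - 1) (M K j) x / (M K (j+1) : ℝ)^(1-t)) atTop (nhds (1 / Real.log 2)) := by
    have := ((hV.mul (hq'.comp (tendsto_add_atTop_nat 1))).mul ((M_ratio K).inv₀ one_ne_zero)).mul
      ((u_ratio ht0 hK0).comp (tendsto_add_atTop_nat 1))
    simp only [one_mul, mul_one, inv_one] at this
    refine this.congr fun j => ?_
    simp only [Function.comp]
    rw [hsplit]
    have := hMpos j
    have := hMpos (j+1)
    have := hupos (j+1)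
    have := q_pos (u t K (j+1) - 1)
    have : 0 < (M K (j+1) : ℝ)^t := by positivity
    field_simp
  have hKr : (0:ℝ) < 1 / K := by positivity
  have hJ : Tendsto (fun m : ℕ => ⌊(m:ℝ)^(1/(K:ℝ))⌋₊ - 1) atTop atTop :=
    (tendsto_sub_atTop_nat 1).comp (tendsto_nat_floor_atTop.comp
      ((tendsto_rpow_atTop hKr).comp tendsto_natCast_atTop_atTop))
  have hJM : ∀ m : ℕ, 1 ≤ m → M K (⌊(m:ℝ)^(1/(K:ℝ))⌋₊ - 1) ≤ m ∧ m ≤ M K (⌊(m:ℝ)^(1/(K:ℝ))⌋₊ - 1 + 1) := by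
    intro m hm
    have hm' : (1:ℝ) ≤ m := by exact_mod_cast hm
    have h1 : 1 ≤ ⌊(m:ℝ)^(1/(K:ℝ))⌋₊ := Nat.le_floor (by simpa using Real.one_le_rpow hm' hKr.le)
    have hp : ((m:ℝ)^(1/(K:ℝ)))^K = m := by
      rw [one_div, Real.rpow_inv_natCast_pow (by positivity) hK0]
    have h0 : 0 ≤ (m:ℝ)^(1/(K:ℝ)) := by positivity
    unfold M
    rw [Nat.sub_add_cancel h1]
    constructor
    · have : ((⌊(m:ℝ)^(1/(K:ℝ))⌋₊ : ℕ) : ℝ)^K ≤ m := by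
        conv_rhs => rw [← hp]
        have := Nat.floor_le h0
        gcongr
      exact_mod_cast this
    · have : (m:ℝ) ≤ ((⌊(m:ℝ)^(1/(K:ℝ))⌋₊ : ℕ) + 1 : ℝ)^K := by
        conv_lhs => rw [← hp]
        have := (Nat.lt_floor_add_one ((m:ℝ)^(1/(K:ℝ)))).le
        gcongr
      exact_mod_cast this
  refine tendsto_of_tendsto_of_tendsto_of_le_of_le' (cV.comp hJ) (cU.comp hJ) ?_ ?_
  · filter_upwards [eventually_ge_atTop 1] with m hm
    obtain ⟨h1, h2⟩ := hJM m hm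
    simp only [Function.comp]
    have hm' : (0:ℝ) < m := by exact_mod_cast hm
    have hS : 0 ≤ S (⌈(m:ℝ)^t⌉₊ - 1) m x := Finset.sum_nonneg fun i _ => Set.indicator_nonneg (fun _ _ => zero_le_one) x
    have h3 : (m:ℝ) ≤ M K (⌊(m:ℝ)^(1/(K:ℝ))⌋₊ - 1 + 1) := by exact_mod_cast h2
    refine div_le_div₀ hS (S_mono ?_ h1 x) (by positivity) ?_
    · unfold u
      gcongr
    · have : 0 ≤ 1 - t := by linarith
      gcongr
  · filter_upwards [eventually_ge_atTop 1] with m hm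
    obtain ⟨h1, h2⟩ := hJM m hm
    simp only [Function.comp]
    have hS : 0 ≤ S (u t K (⌊(m:ℝ)^(1/(K:ℝ))⌋₊ - 1) - 1) (M K (⌊(m:ℝ)^(1/(K:ℝ))⌋₊ - 1 + 1)) x :=
      Finset.sum_nonneg fun i _ => Set.indicator_nonneg (fun _ _ => zero_le_one) x
    have h3 : (M K (⌊(m:ℝ)^(1/(K:ℝ))⌋₊ - 1) : ℝ) ≤ m := by exact_mod_cast h1
    have h4 := hMpos (⌊(m:ℝ)^(1/(K:ℝ))⌋₊ - 1)
    refine div_le_div₀ hS (S_mono ?_ h2 x) (by positivity) ?_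
    · unfold u
      gcongr
    · have : 0 ≤ 1 - t := by linarith
      gcongr

lemma ac : volume.restrict (Set.Ioo (0:ℝ) 1) ≪ mu := by
  refine withDensity_absolutelyContinuous' measw.aemeasurable ?_
  filter_upwards [ae_restrict_mem measurableSet_Ioo] with x hx
  have h0 := hx.1
  have hl := log2pos
  unfold w
  rw [ne_eq, ENNReal.ofReal_eq_zero, not_le]
  positivity

end
end CFaux

/-- **Corollary.** For `t ∈ (0,1)` and Lebesgue-a.e. `x ∈ (0,1)`, the number of `k ≤ m`
with continued fraction coefficient `a_k(x) ≥ m^t` is asymptotic to `m^{1-t} / log 2`.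
Here `a_k(x) = ⌊1 / G^{k-1}(x)⌋` where `G(y) = 1/y mod 1` is the Gauß map. -/
theorem stmt2 (t : ℝ) (ht : t ∈ Set.Ioo (0 : ℝ) 1)
    (G : ℝ → ℝ) (hG : ∀ y, G y = Int.fract y⁻¹)
    (a : ℕ → ℝ → ℤ) (ha : ∀ k x, a k x = ⌊(G^[k - 1] x)⁻¹⌋) :
    ∀ᵐ x ∂(volume.restrict (Set.Ioo (0 : ℝ) 1)),
      Tendsto (fun m : ℕ =>
          ({k : ℕ | 1 ≤ k ∧ k ≤ m ∧ (m : ℝ) ^ t ≤ (a k x : ℝ)}.ncard : ℝ) /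
            (m : ℝ) ^ (1 - t))
        atTop (nhds (1 / Real.log 2)) := by
  have hGG : G = CFaux.G := funext hG
  subst hGG
  filter_upwards [CFaux.ac.ae_le (CFaux.main t ht)] with x hx
  refine hx.congr' ?_
  filter_upwards [eventually_ge_atTop 1] with m hm
  have hm' : (0:ℝ) < m := by exact_mod_cast hm
  simp only [ha]
  rw [CFaux.ncard_eq (by positivity)]
end

section
/- Let (X,T,μ) be a system with exponential decay of correlations for α-Hölder continuous functions, with constants C, τ > 0. Let (B_m)_{m≥1} be a decreasing (nested) sequence of balls B_m = B(x_m, r_m) with r_m < 1, and suppose there are constants C', β > 0 such that μ(B(x_m, r+ρ) \ B(x_m, r)) ≤ C' ρ^β for every m ≥ 1, every ρ ≥ 0 and every 0 < r < 1. Assume the map m ↦ m·μ(B_m) is (weakly) increasing and that there are ε > 0 and m₀ ∈ ℕ such that μ(B_m) ≥ m^{-1+ε} for all m ≥ m₀. Then for μ-almost every x ∈ X, lim_{m→∞} #{ 0 ≤ k < m : T^k(x) ∈ B_m } / (m·μ(B_m)) = 1. -/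
open MeasureTheory Filter

/-- The `α`-Hölder norm: `sup|f| + inf{K ≥ 0 : |f(x) - f(y)| ≤ K d(x,y)^α}`. -/
noncomputable def holderNorm {X : Type*} [MetricSpace X] (α : ℝ) (f : X → ℝ) : ℝ :=
  (⨆ x, |f x|) + sInf {K : ℝ | 0 ≤ K ∧ ∀ x y, |f x - f y| ≤ K * dist x y ^ α}


lemma holder_corr {X : Type*} [MetricSpace X] [MeasurableSpace X] [BorelSpace X]
    (μ : Measure X) [IsProbabilityMeasure μ] (T : X → X)
    (hT : MeasurePreserving T μ μ)
    (α : ℝ) (hα : α ∈ Set.Ioc (0 : ℝ) 1)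
    (C τ : ℝ) (hC : 0 < C) (hτ : 0 < τ)
    (hdec : ∀ (n : ℕ) (f g : X → ℝ),
      (∃ M, ∀ x, |f x| ≤ M) → (∃ K ≥ 0, ∀ x y, |f x - f y| ≤ K * dist x y ^ α) →
      (∃ M, ∀ x, |g x| ≤ M) → (∃ K ≥ 0, ∀ x y, |g x - g y| ≤ K * dist x y ^ α) →
      |(∫ x, f (T^[n] x) * g x ∂μ) - (∫ x, f x ∂μ) * ∫ x, g x ∂μ| ≤
        C * Real.exp (-τ * n) * holderNorm α f * holderNorm α g)
    (c : X) (r : ℝ) (C' β : ℝ) (hC' : 0 < C') (hβ : 0 < β)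
    (hann : ∀ ρ : ℝ, 0 ≤ ρ →
      (μ (Metric.ball c (r + ρ) \ Metric.ball c r)).toReal ≤ C' * ρ ^ β) (n : ℕ) :
    μ.real (Metric.ball c r ∩ T^[n] ⁻¹' Metric.ball c r) - μ.real (Metric.ball c r) ^ 2
      ≤ (2 * C' + C' ^ 2 + 4 * C) * Real.exp (-(min (β * τ / 4) (τ / 2)) * n) := by
  set ρ : ℝ := Real.exp (-τ * n / 4) with hρ
  have hρ0 : 0 < ρ := Real.exp_pos _
  have hn : (0 : ℝ) ≤ n := Nat.cast_nonneg n
  have hρ1 : ρ ≤ 1 := by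
    rw [hρ, Real.exp_le_one_iff]
    nlinarith
  set f : X → ℝ := fun x => max 0 (min 1 ((r + ρ - dist x c) / ρ)) with hf
  have hf0 : ∀ x, 0 ≤ f x := fun x => le_max_left _ _
  have hf1 : ∀ x, f x ≤ 1 := fun x => max_le zero_le_one (min_le_left _ _)
  have hfB : ∀ x, x ∈ Metric.ball c r → f x = 1 := by
    intro x hx
    rw [Metric.mem_ball] at hx
    have : 1 ≤ (r + ρ - dist x c) / ρ := by
      rw [le_div_iff₀ hρ0]; linarith
    simp [hf, min_eq_left this]
  have hfO : ∀ x, x ∉ Metric.ball c (r + ρ) → f x = 0 := by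
    intro x hx
    rw [Metric.mem_ball, not_lt] at hx
    have : (r + ρ - dist x c) / ρ ≤ 0 := by
      apply div_nonpos_of_nonpos_of_nonneg <;> linarith
    simp only [hf]
    exact max_eq_left ((min_le_right _ _).trans this)
  have habs : ∀ x, |f x| ≤ 1 := fun x => by rw [abs_of_nonneg (hf0 x)]; exact hf1 x
  have hfc : Continuous f := by
    simp only [hf]; fun_prop
  have hhold : ∀ x y, |f x - f y| ≤ ρ⁻¹ * dist x y ^ α := by
    intro x y
    have hd : 0 ≤ dist x y := dist_nonneg
    have h1 : |f x - f y| ≤ 1 := by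
      rw [abs_le]; constructor <;> linarith [hf0 x, hf0 y, hf1 x, hf1 y]
    have h2 : |f x - f y| ≤ ρ⁻¹ * dist x y := by
      calc |f x - f y| ≤ |min 1 ((r + ρ - dist x c) / ρ) - min 1 ((r + ρ - dist y c) / ρ)| := by
            have := abs_max_sub_max_le_abs (min 1 ((r + ρ - dist x c) / ρ))
              (min 1 ((r + ρ - dist y c) / ρ)) 0
            simpa [hf, max_comm] using this
        _ ≤ |(r + ρ - dist x c) / ρ - (r + ρ - dist y c) / ρ| := by
            have := abs_min_sub_min_le_max 1 ((r + ρ - dist x c) / ρ) 1 ((r + ρ - dist y c) / ρ)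
            simpa using this
        _ = ρ⁻¹ * |dist y c - dist x c| := by
            rw [← sub_div, abs_div, abs_of_pos hρ0]
            rw [div_eq_inv_mul]; congr 2; ring
        _ ≤ ρ⁻¹ * dist x y := by
            gcongr
            rw [dist_comm x y]
            exact abs_dist_sub_le y x c
    have hi : 1 ≤ ρ⁻¹ := (one_le_inv₀ hρ0).2 hρ1
    rcases le_total (dist x y) 1 with h | h
    · refine h2.trans ?_
      gcongr
      calc dist x y = dist x y ^ (1 : ℝ) := (Real.rpow_one _).symm
        _ ≤ dist x y ^ α := Real.rpow_le_rpow_of_exponent_ge_of_imp hd h hα.2 (by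
            intro _ h'; linarith [hα.1])
    · refine h1.trans ?_
      have : 1 ≤ dist x y ^ α := Real.one_le_rpow h hα.1.le
      nlinarith
  have hne : Nonempty X := ⟨c⟩
  have hi0 : 0 < ρ⁻¹ := inv_pos.2 hρ0
  have hnorm : holderNorm α f ≤ 2 * ρ⁻¹ := by
    have hi : 1 ≤ ρ⁻¹ := (one_le_inv₀ hρ0).2 hρ1
    have h1 : (⨆ x, |f x|) ≤ 1 := ciSup_le habs
    have h2 : sInf {K : ℝ | 0 ≤ K ∧ ∀ x y, |f x - f y| ≤ K * dist x y ^ α} ≤ ρ⁻¹ :=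
      csInf_le ⟨0, fun K hK => hK.1⟩ ⟨hi0.le, hhold⟩
    unfold holderNorm; linarith
  have hnorm0 : 0 ≤ holderNorm α f := by
    unfold holderNorm
    exact add_nonneg (Real.iSup_nonneg fun x => abs_nonneg _) (Real.sInf_nonneg fun K hK => hK.1)
  have hd := hdec n f f ⟨1, habs⟩ ⟨ρ⁻¹, hi0.le, hhold⟩ ⟨1, habs⟩ ⟨ρ⁻¹, hi0.le, hhold⟩
  have hTn : Measurable (T^[n]) := hT.measurable.iterate n
  have hBm : MeasurableSet (Metric.ball c r) := Metric.isOpen_ball.measurableSet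
  have hint : Integrable f μ := Integrable.of_bound hfc.measurable.aestronglyMeasurable 1
    (Eventually.of_forall habs)
  have hint2 : Integrable (fun x => f (T^[n] x) * f x) μ := Integrable.of_bound
    ((hfc.measurable.comp hTn).mul hfc.measurable).aestronglyMeasurable 1
    (Eventually.of_forall fun x => by
      rw [Real.norm_eq_abs, abs_mul]
      exact mul_le_one₀ (habs _) (abs_nonneg _) (habs _))
  have hlow : μ.real (Metric.ball c r ∩ T^[n] ⁻¹' Metric.ball c r)
      ≤ ∫ x, f (T^[n] x) * f x ∂μ := by
    rw [← integral_indicator_one (hBm.inter (hTn hBm))]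
    apply integral_mono _ hint2
    · intro x
      by_cases hx : x ∈ Metric.ball c r ∩ T^[n] ⁻¹' Metric.ball c r
      · simp only [Set.indicator_of_mem hx, Pi.one_apply]
        rw [hfB _ hx.1, hfB _ hx.2]; norm_num
      · simp only [Set.indicator_of_notMem hx]
        exact mul_nonneg (hf0 _) (hf0 _)
    · exact (integrable_const (1 : ℝ)).indicator (hBm.inter (hTn hBm))
  have hup : ∫ x, f x ∂μ ≤ μ.real (Metric.ball c r) + C' * ρ ^ β := by
    calc ∫ x, f x ∂μ ≤ ∫ x, (Metric.ball c (r + ρ)).indicator 1 x ∂μ := by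
          apply integral_mono hint
          · exact (integrable_const (1 : ℝ)).indicator Metric.isOpen_ball.measurableSet
          · intro x
            by_cases hx : x ∈ Metric.ball c (r + ρ)
            · simp only [Set.indicator_of_mem hx, Pi.one_apply]; exact hf1 x
            · simp only [Set.indicator_of_notMem hx]; exact (hfO x hx).le
      _ = μ.real (Metric.ball c (r + ρ)) := integral_indicator_one Metric.isOpen_ball.measurableSet
      _ ≤ μ.real (Metric.ball c r) +
          μ.real (Metric.ball c (r + ρ) \ Metric.ball c r) := by
          rw [measureReal_sdiff (Metric.ball_subset_ball (by linarith)) hBm]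
          linarith
      _ ≤ _ := by
          have := hann ρ hρ0.le
          simp only [measureReal_def] at *
          linarith
  have hf00 : 0 ≤ ∫ x, f x ∂μ := integral_nonneg hf0
  set a := ρ ^ β with ha
  have ha0 : 0 ≤ a := by positivity
  have ha1 : a ≤ 1 := Real.rpow_le_one hρ0.le hρ1 hβ.le
  set b := μ.real (Metric.ball c r)
  have hb0 : 0 ≤ b := measureReal_nonneg
  have hb1 : b ≤ 1 := measureReal_le_one
  have hsq : (∫ x, f x ∂μ) * (∫ x, f x ∂μ) ≤ (b + C' * a) * (b + C' * a) :=
    mul_le_mul hup hup hf00 (by positivity)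
  have hae : a ≤ Real.exp (-(min (β * τ / 4) (τ / 2)) * n) := by
    rw [ha, hρ, ← Real.exp_mul]
    apply Real.exp_le_exp.2
    have := mul_le_mul_of_nonneg_right (min_le_left (β * τ / 4) (τ / 2)) hn
    nlinarith
  have hbe : Real.exp (-τ * n) * (ρ⁻¹ * ρ⁻¹) ≤ Real.exp (-(min (β * τ / 4) (τ / 2)) * n) := by
    rw [hρ, ← Real.exp_neg, ← Real.exp_add, ← Real.exp_add]
    apply Real.exp_le_exp.2
    have := mul_le_mul_of_nonneg_right (min_le_right (β * τ / 4) (τ / 2)) hn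
    nlinarith
  have hlast : C * Real.exp (-τ * n) * holderNorm α f * holderNorm α f
      ≤ 4 * C * (Real.exp (-τ * n) * (ρ⁻¹ * ρ⁻¹)) := by
    have := mul_le_mul hnorm hnorm hnorm0 (by positivity)
    have h2 := mul_le_mul_of_nonneg_left this (mul_pos hC (Real.exp_pos (-τ * n))).le
    nlinarith
  have hd' := (abs_le.1 hd).2
  have h3 : 2 * b * (C' * a) ≤ 2 * C' * a := by
    have : 0 ≤ C' * a := by positivity
    nlinarith
  have h4 : (C' * a) * (C' * a) ≤ C' ^ 2 * a := by
    have : 0 ≤ C' ^ 2 * a := by positivity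
    nlinarith
  set E := Real.exp (-(min (β * τ / 4) (τ / 2)) * n)
  have h5 := mul_le_mul_of_nonneg_left hbe (by positivity : 0 ≤ 4 * C)
  have h6 := mul_le_mul_of_nonneg_left hae (by positivity : 0 ≤ 2 * C' + C' ^ 2)
  nlinarith

lemma geom_sum_aux (q : ℝ) (hq0 : 0 ≤ q) (hq1 : q < 1) (N : ℕ) :
    ∑ j ∈ Finset.range N, q ^ (N - j) ≤ q / (1 - q) := by
  induction N with
  | zero => simp; exact div_nonneg hq0 (by linarith)
  | succ N ih =>
    rw [Finset.sum_range_succ]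
    have : ∑ j ∈ Finset.range N, q ^ (N + 1 - j) = q * ∑ j ∈ Finset.range N, q ^ (N - j) := by
      rw [Finset.mul_sum]
      apply Finset.sum_congr rfl
      intro j hj
      rw [Finset.mem_range] at hj
      rw [← pow_succ']; congr 1; omega
    rw [this]
    have h := mul_le_mul_of_nonneg_left ih hq0
    have h1 : (1 - q) ≠ 0 := by linarith
    have h2 : q * (q / (1 - q)) + q = q / (1 - q) := by field_simp; ring
    simp only [Nat.add_sub_cancel_left, pow_one]
    linarith

lemma var_bound {X : Type*} [MeasurableSpace X]
    (μ : Measure X) [IsProbabilityMeasure μ] (T : X → X)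
    (hT : MeasurePreserving T μ μ) (B : Set X) (hB : MeasurableSet B)
    (G q : ℝ) (hG : 0 ≤ G) (hq0 : 0 ≤ q) (hq1 : q < 1)
    (h : ∀ n : ℕ, μ.real (B ∩ T^[n] ⁻¹' B) - μ.real B ^ 2 ≤ G * q ^ n) (N : ℕ) :
    ∫ x, (∑ j ∈ Finset.range N, (B.indicator 1 (T^[j] x) - μ.real B)) ^ 2 ∂μ
      ≤ N * (2 * G / (1 - q)) := by
  set g : ℕ → X → ℝ := fun j x => B.indicator 1 (T^[j] x) - μ.real B with hg
  have hTn : ∀ n, Measurable (T^[n]) := fun n => hT.measurable.iterate n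
  have hgm : ∀ j, Measurable (g j) := fun j =>
    ((measurable_one.indicator hB).comp (hTn j)).sub_const _
  have hb0 : 0 ≤ μ.real B := measureReal_nonneg
  have hb1 : μ.real B ≤ 1 := measureReal_le_one
  have hgb : ∀ j x, |g j x| ≤ 1 := by
    intro j x
    simp only [hg]
    by_cases hx : T^[j] x ∈ B
    · simp only [Set.indicator_of_mem hx, Pi.one_apply]; rw [abs_le]; constructor <;> linarith
    · simp only [Set.indicator_of_notMem hx]; rw [abs_le]; constructor <;> linarith
  have hgi : ∀ i j, Integrable (fun x => g i x * g j x) μ := fun i j =>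
    Integrable.of_bound ((hgm i).mul (hgm j)).aestronglyMeasurable 1
      (Eventually.of_forall fun x => by
        rw [Real.norm_eq_abs, abs_mul]
        exact mul_le_one₀ (hgb _ _) (abs_nonneg _) (hgb _ _))
  have hcov : ∀ j n, ∫ x, g j x * g (j + n) x ∂μ ≤ G * q ^ n := by
    intro j n
    refine le_trans (le_of_eq ?_) (h n)
    have hIi : ∀ S : Set X, MeasurableSet S → Integrable (S.indicator (1 : X → ℝ)) μ := fun S hS =>
      (integrable_const (1 : ℝ)).indicator hS
    have e1 : ∀ x, g j x * g (j + n) x = (fun y => g 0 y * g n y) (T^[j] x) := by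
      intro x
      simp only [hg]
      rw [add_comm j n, Function.iterate_add_apply]; rfl
    have hmp := hT.iterate j
    rw [integral_congr_ae (Eventually.of_forall e1)]
    have e2 : ∫ x, (fun y => g 0 y * g n y) (T^[j] x) ∂μ = ∫ y, g 0 y * g n y ∂μ := by
      conv_rhs => rw [← hmp.map_eq]
      rw [integral_map hmp.measurable.aemeasurable]
      exact ((hgm 0).mul (hgm n)).aestronglyMeasurable
    rw [e2]
    have e3 : ∀ y, g 0 y * g n y = (B ∩ T^[n] ⁻¹' B).indicator 1 y - μ.real B * B.indicator 1 y
        - μ.real B * (T^[n] ⁻¹' B).indicator 1 y + μ.real B ^ 2 := by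
      intro y
      simp only [hg, Function.iterate_zero, id, Set.indicator_apply, Set.mem_inter_iff,
        Set.mem_preimage, Pi.one_apply]
      by_cases h1 : y ∈ B <;> by_cases h2 : T^[n] y ∈ B <;> simp [h1, h2] <;> ring
    rw [integral_congr_ae (Eventually.of_forall e3)]
    have hA := hIi _ (hB.inter (hTn n hB))
    have hB' := (hIi _ hB).const_mul (μ.real B)
    have hC' := (hIi _ (hTn n hB)).const_mul (μ.real B)
    have hAB : Integrable (fun y => (B ∩ T^[n] ⁻¹' B).indicator 1 y
        - μ.real B * B.indicator 1 y) μ := hA.sub hB'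
    have hABC : Integrable (fun y => (B ∩ T^[n] ⁻¹' B).indicator 1 y
        - μ.real B * B.indicator 1 y - μ.real B * (T^[n] ⁻¹' B).indicator 1 y) μ := hAB.sub hC'
    rw [integral_add hABC (integrable_const _),
      integral_sub hAB hC', integral_sub hA hB', integral_const_mul, integral_const_mul,
      integral_indicator_one (hB.inter (hTn n hB)), integral_indicator_one hB,
      integral_indicator_one (hTn n hB)]
    have : μ.real (T^[n] ⁻¹' B) = μ.real B := by
      simp only [measureReal_def]
      rw [(hT.iterate n).measure_preimage hB.nullMeasurableSet]
    rw [this]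
    simp
    ring
  have hSm : ∀ N, Measurable fun x => ∑ j ∈ Finset.range N, g j x := fun N =>
    Finset.measurable_sum _ fun j _ => hgm j
  have hSb : ∀ N x, |∑ j ∈ Finset.range N, g j x| ≤ N := by
    intro N x
    refine (Finset.abs_sum_le_sum_abs _ _).trans ?_
    refine (Finset.sum_le_sum fun j _ => hgb j x).trans ?_
    simp
  change ∫ x, (∑ j ∈ Finset.range N, g j x) ^ 2 ∂μ ≤ _
  induction N with
  | zero => simp
  | succ N ih =>
    have e : ∀ x, (∑ j ∈ Finset.range (N + 1), g j x) ^ 2 =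
        (∑ j ∈ Finset.range N, g j x) ^ 2 + 2 * (∑ j ∈ Finset.range N, g j x * g N x)
          + g N x * g N x := by
      intro x
      rw [Finset.sum_range_succ, ← Finset.sum_mul]; ring
    have i1 : Integrable (fun x => (∑ j ∈ Finset.range N, g j x) ^ 2) μ :=
      Integrable.of_bound ((hSm N).pow_const 2).aestronglyMeasurable ((N : ℝ) ^ 2)
        (Eventually.of_forall fun x => by
          rw [Real.norm_eq_abs, abs_pow]
          exact pow_le_pow_left₀ (abs_nonneg _) (hSb N x) 2)
    have i2 : Integrable (fun x => ∑ j ∈ Finset.range N, g j x * g N x) μ :=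
      integrable_finsetSum _ fun j _ => hgi j N
    have i3 : Integrable (fun x => (∑ j ∈ Finset.range N, g j x) ^ 2 +
        2 * ∑ j ∈ Finset.range N, g j x * g N x) μ := i1.add (i2.const_mul 2)
    rw [integral_congr_ae (Eventually.of_forall e), integral_add i3 (hgi N N),
      integral_add i1 (i2.const_mul 2), integral_const_mul, integral_finsetSum _ fun j _ => hgi j N]
    have h1 : ∑ j ∈ Finset.range N, ∫ x, g j x * g N x ∂μ ≤ G * (q / (1 - q)) := by
      calc _ ≤ ∑ j ∈ Finset.range N, G * q ^ (N - j) := by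
            apply Finset.sum_le_sum
            intro j hj
            have := hcov j (N - j)
            rwa [Nat.add_sub_cancel' (Finset.mem_range.1 hj).le] at this
        _ = G * ∑ j ∈ Finset.range N, q ^ (N - j) := by rw [Finset.mul_sum]
        _ ≤ _ := mul_le_mul_of_nonneg_left (geom_sum_aux q hq0 hq1 N) hG
    have h2 : ∫ x, g N x * g N x ∂μ ≤ G := by simpa using hcov N 0
    have h3 : (1 - q) ≠ 0 := by linarith
    have h4 : 2 * (G * (q / (1 - q))) + 2 * G = 2 * G / (1 - q) := by field_simp; ring
    push_cast
    nlinarith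

lemma ae_tendsto_zero {X : Type*} [MeasurableSpace X] (μ : Measure X)
    (F : ℕ → X → ℝ) (hF : ∀ n, Integrable (F n) μ) (hF0 : ∀ n x, 0 ≤ F n x)
    (b : ℕ → ℝ) (hb : Summable b) (h : ∀ᶠ n in atTop, ∫ x, F n x ∂μ ≤ b n) :
    ∀ᵐ x ∂μ, Tendsto (fun n => F n x) atTop (nhds 0) := by
  have hs : Summable fun n => ∫ x, F n x ∂μ := by
    obtain ⟨K, hK⟩ := eventually_atTop.1 h
    rw [← summable_nat_add_iff K]
    refine Summable.of_nonneg_of_le (fun n => integral_nonneg (hF0 _)) (fun n => hK (n + K) (by omega))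
      ((summable_nat_add_iff K).2 hb)
  have hfin : ∫⁻ x, ∑' n, ENNReal.ofReal (F n x) ∂μ ≠ ⊤ := by
    rw [lintegral_tsum fun n => (hF n).aestronglyMeasurable.aemeasurable.ennreal_ofReal]
    simp_rw [← fun n => ofReal_integral_eq_lintegral_ofReal (hF n) (Eventually.of_forall (hF0 n))]
    rw [← ENNReal.ofReal_tsum_of_nonneg (fun n => integral_nonneg (hF0 n)) hs]
    exact ENNReal.ofReal_ne_top
  have := ae_lt_top' (AEMeasurable.tsum fun n => (hF n).aestronglyMeasurable.aemeasurable.ennreal_ofReal) hfin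
  filter_upwards [this] with x hx
  have h1 := ENNReal.tendsto_atTop_zero_of_tsum_ne_top hx.ne
  have h2 := (ENNReal.tendsto_toReal (ENNReal.zero_ne_top)).comp h1
  simpa [Function.comp_def, ENNReal.toReal_ofReal (hF0 _ x)] using h2

lemma ratio_tendsto {X : Type*} [MeasurableSpace X]
    (μ : Measure X) [IsProbabilityMeasure μ] (T : X → X)
    (hT : MeasurePreserving T μ μ) (B : ℕ → Set X) (hBm : ∀ m, MeasurableSet (B m))
    (A γ : ℝ) (hA : 0 < A) (hγ : 0 < γ)
    (hcorr : ∀ m n : ℕ, μ.real (B m ∩ T^[n] ⁻¹' B m) - μ.real (B m) ^ 2 ≤ A * Real.exp (-γ * n))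
    (e : ℝ) (he0 : 0 < e) (he1 : e ≤ 1) (m₀ : ℕ)
    (hlow : ∀ m : ℕ, m₀ ≤ m → 1 ≤ m → (m : ℝ) ^ (-1 + e) ≤ μ.real (B m))
    (N M : ℕ → ℕ) (D : ℝ) (hD : 0 < D) (hMN : ∀ k, 1 ≤ k → (M k : ℝ) ≤ D * N k)
    (p : ℕ) (hp : 4 ≤ p * e) (hM : ∀ k, k ^ p ≤ M k) :
    ∀ᵐ x ∂μ, Tendsto (fun k => (∑ j ∈ Finset.range (N k), (B (M k)).indicator 1 (T^[j] x)) /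
      ((N k : ℝ) * μ.real (B (M k)))) atTop (nhds 1) := by
  set θ := e / 2 with hθ
  set q := Real.exp (-γ * θ) with hq
  set H := A ^ θ with hH
  have hH0 : 0 < H := Real.rpow_pos_of_pos hA _
  have hq0 : 0 < q := Real.exp_pos _
  have hq1 : q < 1 := by
    rw [hq, Real.exp_lt_one_iff]
    have : 0 < γ * θ := by positivity
    linarith
  have hb1 : ∀ m, μ.real (B m) ≤ 1 := fun m => measureReal_le_one
  have hb0 : ∀ m, 0 ≤ μ.real (B m) := fun m => measureReal_nonneg
  have hpow : ∀ m n : ℕ, 0 < μ.real (B m) →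
      μ.real (B m ∩ T^[n] ⁻¹' B m) - μ.real (B m) ^ 2 ≤ (H * μ.real (B m) ^ (1 - θ)) * q ^ n := by
    intro m n hpos
    set v := μ.real (B m ∩ T^[n] ⁻¹' B m) - μ.real (B m) ^ 2 with hv
    have hR : 0 ≤ (H * μ.real (B m) ^ (1 - θ)) * q ^ n := by positivity
    rcases le_or_gt v 0 with h0 | h0
    · exact h0.trans hR
    have h1 : v ≤ μ.real (B m) := by
      have : μ.real (B m ∩ T^[n] ⁻¹' B m) ≤ μ.real (B m) :=
        measureReal_mono Set.inter_subset_left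
      nlinarith
    have h2 := hcorr m n
    calc v = v ^ (θ + (1 - θ)) := by rw [add_sub_cancel, Real.rpow_one]
      _ = v ^ θ * v ^ (1 - θ) := Real.rpow_add h0 _ _
      _ ≤ (A * Real.exp (-γ * n)) ^ θ * μ.real (B m) ^ (1 - θ) := by
          apply mul_le_mul
          · exact Real.rpow_le_rpow h0.le h2 (by positivity)
          · exact Real.rpow_le_rpow h0.le h1 (by linarith)
          · positivity
          · positivity
      _ = _ := by
          rw [Real.mul_rpow hA.le (Real.exp_pos _).le, ← Real.exp_mul, hq, ← Real.exp_nat_mul]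
          rw [show -γ * n * θ = n * (-γ * θ) by ring]
          ring
  have hp0 : p ≠ 0 := by
    rintro rfl
    norm_num at hp
  set K := 2 * H / (1 - q) * D with hK
  have h1q : 0 < 1 - q := by linarith
  have hK0 : 0 < K := by positivity
  have hkM : ∀ k, k ≤ M k := fun k => (Nat.le_self_pow hp0 k).trans (hM k)
  have hgood : ∀ k : ℕ, max m₀ 1 ≤ k → 0 < (N k : ℝ) * μ.real (B (M k)) := by
    intro k hk
    have hk1 : 1 ≤ k := (le_max_right _ _).trans hk
    have hM1 : 1 ≤ M k := hk1.trans (hkM k)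
    have hM0 : (0 : ℝ) < M k := by exact_mod_cast hM1
    have h1 : 0 < μ.real (B (M k)) := lt_of_lt_of_le (Real.rpow_pos_of_pos hM0 _)
      (hlow _ (((le_max_left _ _).trans hk).trans (hkM k)) hM1)
    have h2 : 0 < (N k : ℝ) := by
      have := hMN k hk1
      by_contra hcon
      have : D * N k ≤ 0 := mul_nonpos_of_nonneg_of_nonpos hD.le (not_lt.1 hcon)
      linarith
    positivity
  set F : ℕ → X → ℝ := fun k x =>
    (∑ j ∈ Finset.range (N k), ((B (M k)).indicator 1 (T^[j] x) - μ.real (B (M k)))) ^ 2 /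
      ((N k : ℝ) * μ.real (B (M k))) ^ 2 with hF
  have hmain : ∀ᵐ x ∂μ, Tendsto (fun k => F k x) atTop (nhds 0) := by
    apply ae_tendsto_zero μ F _ _ (fun k => K * (1 / (k : ℝ) ^ 2))
    · exact (Real.summable_one_div_nat_pow.2 one_lt_two).mul_left K
    · filter_upwards [eventually_ge_atTop (max m₀ 1)] with k hk
      have hk1 : 1 ≤ k := (le_max_right _ _).trans hk
      have hM1 : 1 ≤ M k := hk1.trans (hkM k)
      have hM0 : (0 : ℝ) < M k := by exact_mod_cast hM1
      have hg := hgood k hk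
      have hlowk := hlow _ (((le_max_left _ _).trans hk).trans (hkM k)) hM1
      set b := μ.real (B (M k)) with hb
      have hbpos : 0 < b := pos_of_mul_pos_right hg (Nat.cast_nonneg _)
      have hNpos : (0 : ℝ) < N k := pos_of_mul_pos_left hg hbpos.le
      have hv := var_bound μ T hT (B (M k)) (hBm _) (H * b ^ (1 - θ)) q (by positivity) hq0.le hq1
        (fun n => hpow (M k) n hbpos) (N k)
      simp only [hF]
      rw [integral_div]
      have h1 : (k : ℝ) ^ 2 ≤ (M k : ℝ) * b ^ (1 + θ) := by
        have hk1' : (1 : ℝ) ≤ k := by exact_mod_cast hk1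
        calc (k : ℝ) ^ 2 = (k : ℝ) ^ (2 : ℝ) := by norm_cast
          _ ≤ (k : ℝ) ^ (p * (e / 2)) := Real.rpow_le_rpow_of_exponent_le hk1' (by linarith)
          _ = ((k : ℝ) ^ p) ^ (e / 2) := by
              rw [Real.rpow_mul (by positivity), Real.rpow_natCast]
          _ ≤ (M k : ℝ) ^ (e / 2) :=
              Real.rpow_le_rpow (by positivity) (by exact_mod_cast hM k) (by positivity)
          _ ≤ (M k : ℝ) ^ (1 + (-1 + e) * (1 + θ)) := by
              apply Real.rpow_le_rpow_of_exponent_le (by exact_mod_cast hM1)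
              rw [hθ]; nlinarith
          _ = (M k : ℝ) * ((M k : ℝ) ^ (-1 + e)) ^ (1 + θ) := by
              rw [Real.rpow_add hM0, Real.rpow_one, Real.rpow_mul hM0.le]
          _ ≤ _ := by
              gcongr
      have hbb : b ^ (1 - θ) * b ^ (1 + θ) = b ^ 2 := by
        rw [← Real.rpow_add hbpos]
        rw [show (1 - θ) + (1 + θ) = ((2 : ℕ) : ℝ) by push_cast; ring, Real.rpow_natCast]
      have h2 : (k : ℝ) ^ 2 ≤ D * N k * b ^ (1 + θ) :=
        h1.trans (by gcongr; exact hMN k hk1)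
      have hk2 : (0 : ℝ) < (k : ℝ) ^ 2 := by
        have : (0 : ℝ) < k := by exact_mod_cast hk1
        positivity
      rw [div_le_iff₀ (by positivity)]
      refine hv.trans ?_
      have h3 : K * (1 / (k : ℝ) ^ 2) * (N k * b) ^ 2 =
          (N k * (2 * (H * b ^ (1 - θ)) / (1 - q))) * ((D * N k * b ^ (1 + θ)) / (k : ℝ) ^ 2) := by
        rw [mul_pow, ← hbb, hK]
        field_simp
      rw [h3]
      apply le_mul_of_one_le_right (by positivity)
      rwa [le_div_iff₀ hk2, one_mul]
    · intro k
      apply Integrable.div_const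
      refine Integrable.of_bound (C := ((N k : ℝ)) ^ 2) (Measurable.aestronglyMeasurable ?_)
        (Eventually.of_forall fun x => ?_)
      · apply Measurable.pow_const
        refine Finset.measurable_sum _ fun j _ => ?_
        exact ((measurable_one.indicator (hBm _)).comp (hT.measurable.iterate j)).sub_const _
      · rw [Real.norm_eq_abs, abs_pow]
        refine pow_le_pow_left₀ (abs_nonneg _) ?_ 2
        refine (Finset.abs_sum_le_sum_abs _ _).trans ?_
        refine (Finset.sum_le_sum (g := fun _ => (1 : ℝ)) fun j _ => ?_).trans (by simp)
        have h0 := hb0 (M k)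
        have h1 := hb1 (M k)
        by_cases hx : T^[j] x ∈ B (M k)
        · simp only [Set.indicator_of_mem hx, Pi.one_apply]
          rw [abs_le]; constructor <;> linarith
        · simp only [Set.indicator_of_notMem hx]
          rw [abs_le]; constructor <;> linarith
    · intro k x
      simp only [hF]; positivity
  filter_upwards [hmain] with x hx
  have h1 : Tendsto (fun k => √(F k x)) atTop (nhds 0) := by
    have := (Real.continuous_sqrt.tendsto 0).comp hx
    simpa [Function.comp_def] using this
  rw [tendsto_iff_dist_tendsto_zero]
  refine h1.congr' ?_
  filter_upwards [eventually_ge_atTop (max m₀ 1)] with k hk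
  have hg := hgood k hk
  simp only [hF]
  rw [← div_pow, Real.sqrt_sq_eq_abs, Real.dist_eq, Finset.sum_sub_distrib]
  congr 1
  simp only [Finset.sum_const, Finset.card_range, nsmul_eq_mul]
  rw [sub_div, div_self hg.ne']

lemma ncard_eq_sum {X : Type*} (T : X → X) (B : Set X) (m : ℕ) (x : X) :
    ({k : ℕ | k < m ∧ T^[k] x ∈ B}.ncard : ℝ) =
      ∑ j ∈ Finset.range m, B.indicator 1 (T^[j] x) := by
  classical
  have : {k : ℕ | k < m ∧ T^[k] x ∈ B} =
      ((Finset.range m).filter fun k => T^[k] x ∈ B : Finset ℕ) := by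
    ext k; simp
  rw [this, Set.ncard_coe_finset, Finset.card_filter]
  push_cast
  apply Finset.sum_congr rfl
  intro j _
  simp [Set.indicator_apply]

lemma sum_ind_mono {X : Type*} (T : X → X) {A B : Set X} (hAB : A ⊆ B) {m n : ℕ} (hmn : m ≤ n)
    (x : X) : ∑ j ∈ Finset.range m, A.indicator (1 : X → ℝ) (T^[j] x) ≤
      ∑ j ∈ Finset.range n, B.indicator (1 : X → ℝ) (T^[j] x) := by
  calc _ ≤ ∑ j ∈ Finset.range m, B.indicator (1 : X → ℝ) (T^[j] x) :=
        Finset.sum_le_sum fun j _ =>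
          Set.indicator_le_indicator_of_subset hAB (fun _ => zero_le_one) _
    _ ≤ _ := Finset.sum_le_sum_of_subset_of_nonneg (Finset.range_mono hmn) fun j _ _ =>
        Set.indicator_nonneg (fun _ _ => zero_le_one) _

/-- **Theorem 4 (Hölder 2).** Under exponential decay of correlations for `α`-Hölder
functions and the annulus condition at the centres, for a nested sequence of balls with
`m ↦ m μ(B_m)` increasing and `μ(B_m) ≥ m^{-1+ε}`, for a.e. `x` the number of `k < m`
with `T^k x ∈ B_m` is asymptotic to `m μ(B_m)`. -/
theorem stmt4 {X : Type*} [MetricSpace X] [MeasurableSpace X] [BorelSpace X]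
    (μ : Measure X) [IsProbabilityMeasure μ] (T : X → X)
    (hT : MeasurePreserving T μ μ)
    (α : ℝ) (hα : α ∈ Set.Ioc (0 : ℝ) 1)
    (C τ : ℝ) (hC : 0 < C) (hτ : 0 < τ)
    (hdec : ∀ (n : ℕ) (f g : X → ℝ),
      (∃ M, ∀ x, |f x| ≤ M) → (∃ K ≥ 0, ∀ x y, |f x - f y| ≤ K * dist x y ^ α) →
      (∃ M, ∀ x, |g x| ≤ M) → (∃ K ≥ 0, ∀ x y, |g x - g y| ≤ K * dist x y ^ α) →
      |(∫ x, f (T^[n] x) * g x ∂μ) - (∫ x, f x ∂μ) * ∫ x, g x ∂μ| ≤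
        C * Real.exp (-τ * n) * holderNorm α f * holderNorm α g)
    (c : ℕ → X) (r : ℕ → ℝ) (hr : ∀ m, 0 < r m) (hr1 : ∀ m, r m < 1)
    (hnest : ∀ m, Metric.ball (c (m + 1)) (r (m + 1)) ⊆ Metric.ball (c m) (r m))
    (C' β : ℝ) (hC' : 0 < C') (hβ : 0 < β)
    (hann : ∀ m : ℕ, ∀ ρ : ℝ, 0 ≤ ρ → ∀ s : ℝ, 0 < s → s < 1 →
      (μ (Metric.ball (c m) (s + ρ) \ Metric.ball (c m) s)).toReal ≤ C' * ρ ^ β)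
    (hmono : Monotone fun m : ℕ => (m : ℝ) * (μ (Metric.ball (c m) (r m))).toReal)
    (ε : ℝ) (hε : 0 < ε) (m₀ : ℕ)
    (hB : ∀ m : ℕ, m₀ ≤ m →
      (m : ℝ) ^ (-1 + ε) ≤ (μ (Metric.ball (c m) (r m))).toReal) :
    ∀ᵐ x ∂μ, Tendsto (fun m : ℕ =>
        ({k : ℕ | k < m ∧ T^[k] x ∈ Metric.ball (c m) (r m)}.ncard : ℝ) /
          ((m : ℝ) * (μ (Metric.ball (c m) (r m))).toReal))
      atTop (nhds 1) := by
  set B : ℕ → Set X := fun m => Metric.ball (c m) (r m) with hBdef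
  have hBm : ∀ m, MeasurableSet (B m) := fun m => Metric.isOpen_ball.measurableSet
  have hanti : Antitone B := antitone_nat_of_succ_le hnest
  set γ := min (β * τ / 4) (τ / 2) with hγ
  have hγ0 : 0 < γ := lt_min (by positivity) (by positivity)
  have hcorr : ∀ m n : ℕ, μ.real (B m ∩ T^[n] ⁻¹' B m) - μ.real (B m) ^ 2 ≤
      (2 * C' + C' ^ 2 + 4 * C) * Real.exp (-γ * n) := fun m n =>
    holder_corr μ T hT α hα C τ hC hτ hdec (c m) (r m) C' β hC' hβ
      (fun ρ hρ => hann m ρ hρ (r m) (hr m) (hr1 m)) n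
  set e := min ε 1 with he
  have he0 : 0 < e := lt_min hε one_pos
  have hlow : ∀ m : ℕ, m₀ ≤ m → 1 ≤ m → (m : ℝ) ^ (-1 + e) ≤ μ.real (B m) := by
    intro m hm hm1
    refine le_trans ?_ (hB m hm)
    exact Real.rpow_le_rpow_of_exponent_le (by exact_mod_cast hm1)
      (by linarith [min_le_left ε 1])
  obtain ⟨p, hp⟩ := exists_nat_ge (4 / e)
  rw [div_le_iff₀ he0] at hp
  have hp0 : p ≠ 0 := by
    rintro rfl
    norm_num at hp
  have hA : 0 < 2 * C' + C' ^ 2 + 4 * C := by positivity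
  have hU := ratio_tendsto μ T hT B hBm _ γ hA hγ0 hcorr e he0 (min_le_right _ _) m₀ hlow
    (fun k => (k + 1) ^ p) (fun k => k ^ p) 1 one_pos
    (fun k _ => by
      rw [one_mul]
      exact_mod_cast Nat.pow_le_pow_left (Nat.le_succ k) p) p hp (fun k => le_rfl)
  have hL := ratio_tendsto μ T hT B hBm _ γ hA hγ0 hcorr e he0 (min_le_right _ _) m₀ hlow
    (fun k => k ^ p) (fun k => (k + 1) ^ p) (2 ^ p) (by positivity)
    (fun k hk => by
      push_cast
      rw [← mul_pow]
      have : (1 : ℝ) ≤ k := by exact_mod_cast hk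
      gcongr
      linarith) p hp (fun k => Nat.pow_le_pow_left (Nat.le_succ k) p)
  -- ratio of consecutive times
  have hratio : Tendsto (fun k : ℕ => (((k + 1) ^ p : ℕ) : ℝ) / ((k ^ p : ℕ) : ℝ)) atTop (nhds 1) := by
    have h1 : Tendsto (fun k : ℕ => 1 + 1 / (k : ℝ)) atTop (nhds (1 + 0)) :=
      tendsto_const_nhds.add tendsto_one_div_atTop_nhds_zero_nat
    have h2 := h1.pow p
    rw [add_zero, one_pow] at h2
    refine h2.congr' ?_
    filter_upwards [eventually_ge_atTop 1] with k hk
    have : (k : ℝ) ≠ 0 := by positivity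
    push_cast
    rw [← div_pow]
    congr 1
    field_simp
  have hratio' : Tendsto (fun k : ℕ => ((k ^ p : ℕ) : ℝ) / (((k + 1) ^ p : ℕ) : ℝ)) atTop (nhds 1) := by
    have := hratio.inv₀ one_ne_zero
    simpa using this
  -- index function
  have hkex : ∀ m : ℕ, ∃ k, k ^ p ≤ m ∧ m < (k + 1) ^ p := by
    intro m
    refine ⟨Nat.findGreatest (fun k => k ^ p ≤ m) m, ?_, ?_⟩
    · exact Nat.findGreatest_spec (P := fun k => k ^ p ≤ m) (Nat.zero_le m) (by simp [hp0])
    · by_contra hcon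
      rw [not_lt] at hcon
      have := Nat.le_findGreatest (P := fun k => k ^ p ≤ m)
        ((Nat.le_self_pow hp0 _).trans hcon) hcon
      omega
  choose κ hκ1 hκ2 using hkex
  have hκ : Tendsto κ atTop atTop := by
    rw [tendsto_atTop]
    intro K
    filter_upwards [eventually_ge_atTop (K ^ p)] with m hm
    have := lt_of_pow_lt_pow_left₀ p (Nat.zero_le _) (hm.trans_lt (hκ2 m))
    omega
  filter_upwards [hU, hL] with x hUx hLx
  have hup := ((hUx.mul hratio).comp hκ)
  have hlo := ((hLx.mul hratio').comp hκ)
  rw [mul_one] at hup hlo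
  refine tendsto_of_tendsto_of_tendsto_of_le_of_le' hlo hup ?_ ?_
  · filter_upwards [eventually_ge_atTop (max m₀ 1), hκ.eventually_ge_atTop (max m₀ 1)] with m hm hk
    have hm0 : (0 : ℝ) < m := by exact_mod_cast (le_max_right _ _).trans hm
    have hbm : 0 < μ.real (B m) := lt_of_lt_of_le (Real.rpow_pos_of_pos hm0 _)
      (hlow m ((le_max_left _ _).trans hm) ((le_max_right _ _).trans hm))
    have hEm : (m : ℝ) * μ.real (B m) ≤ (((κ m + 1) ^ p : ℕ) : ℝ) * μ.real (B ((κ m + 1) ^ p)) :=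
      hmono (hκ2 m).le
    have hS := sum_ind_mono T (hanti (hκ2 m).le) (hκ1 m) x
    have hk0 : (((κ m) ^ p : ℕ) : ℝ) ≠ 0 := by
      have : 1 ≤ κ m := (le_max_right _ _).trans hk
      positivity
    have hE0 : 0 < (m : ℝ) * μ.real (B m) := by positivity
    have hS0 : 0 ≤ ∑ j ∈ Finset.range m, (B m).indicator (1 : X → ℝ) (T^[j] x) :=
      Finset.sum_nonneg fun j _ => Set.indicator_nonneg (fun _ _ => zero_le_one) _
    rw [ncard_eq_sum]
    simp only [Function.comp]
    rw [div_mul_div_comm, mul_comm (∑ j ∈ Finset.range (κ m ^ p), _), mul_assoc,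
      mul_div_mul_left _ _ hk0, mul_comm (μ.real _)]
    exact div_le_div₀ hS0 hS hE0 hEm
  · filter_upwards [eventually_ge_atTop (max m₀ 1), hκ.eventually_ge_atTop (max m₀ 1)] with m hm hk
    have hk1 : 1 ≤ κ m := (le_max_right _ _).trans hk
    have hkp : κ m ≤ κ m ^ p := Nat.le_self_pow hp0 _
    have hkp0 : (0 : ℝ) < ((κ m ^ p : ℕ) : ℝ) := by positivity
    have hbk : 0 < μ.real (B (κ m ^ p)) := lt_of_lt_of_le (Real.rpow_pos_of_pos hkp0 _)
      (hlow _ (((le_max_left _ _).trans hk).trans hkp) (hk1.trans hkp))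
    have hEm : ((κ m ^ p : ℕ) : ℝ) * μ.real (B (κ m ^ p)) ≤ (m : ℝ) * μ.real (B m) :=
      hmono (hκ1 m)
    have hS := sum_ind_mono T (hanti (hκ1 m)) (hκ2 m).le x
    have hk0 : (((κ m + 1) ^ p : ℕ) : ℝ) ≠ 0 := by positivity
    have hE0 : 0 < ((κ m ^ p : ℕ) : ℝ) * μ.real (B (κ m ^ p)) := by positivity
    have hS0 : 0 ≤ ∑ j ∈ Finset.range ((κ m + 1) ^ p),
        (B (κ m ^ p)).indicator (1 : X → ℝ) (T^[j] x) :=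
      Finset.sum_nonneg fun j _ => Set.indicator_nonneg (fun _ _ => zero_le_one) _
    rw [ncard_eq_sum]
    simp only [Function.comp]
    rw [div_mul_div_comm, mul_comm (∑ j ∈ Finset.range ((κ m + 1) ^ p), _), mul_assoc,
      mul_div_mul_left _ _ hk0, mul_comm (μ.real _)]
    exact div_le_div₀ hS0 hS hE0 hEm
end

section
/- Let (X,T,μ) be a system with exponential decay of correlations for functions of bounded variation against L¹, with constants C, τ > 0. Let ε ∈ (0,1), let (B_m)_{m≥1} be a sequence of intervals in X with μ(B_m) ≥ m^{-1+ε} for all m ≥ 1, set m_n = ⌈n^{2/ε}⌉ and S_n(x) = Σ_{k=m_n}^{m_{n+1}−1} 1_{B_{m_n}}(T^k x). Then for μ-almost every x ∈ X, lim_{n→∞} n · S_n(x)/(m_n μ(B_{m_n})) = 2/ε; in particular S_n(x)/(m_n μ(B_{m_n})) → 0 almost everywhere. -/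
open MeasureTheory Filter

lemma ev_mono (f : ℝ → ℝ) (hf : Monotone f) (h0 : ∀ x, 0 ≤ f x) (h1 : ∀ x, f x ≤ 1) :
    eVariationOn f Set.univ ≤ 1 := by
  unfold eVariationOn
  refine iSup_le ?_
  rintro ⟨n, u, hu, -⟩
  have : ∑ i ∈ Finset.range n, edist (f (u (i+1))) (f (u i))
      = ENNReal.ofReal (∑ i ∈ Finset.range n, (f (u (i+1)) - f (u i))) := by
    rw [ENNReal.ofReal_sum_of_nonneg]
    · refine Finset.sum_congr rfl fun i _ => ?_
      rw [edist_dist, Real.dist_eq, abs_of_nonneg]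
      exact sub_nonneg.2 (hf (hu (Nat.le_succ i)))
    · intro i _
      exact sub_nonneg.2 (hf (hu (Nat.le_succ i)))
  simp only [this]
  rw [Finset.sum_range_sub (fun i => f (u i))]
  rw [ENNReal.ofReal_le_one]
  linarith [h0 (u 0), h1 (u n)]

lemma ind_mono (U : Set ℝ) (hU : IsUpperSet U) : eVariationOn (U.indicator (fun _ => (1:ℝ))) Set.univ ≤ 1 := by
  apply ev_mono
  · intro x y hxy
    by_cases hx : x ∈ U
    · simp [hx, hU hxy hx]
    · simp only [hx, not_false_eq_true, Set.indicator_of_notMem]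
      exact Set.indicator_nonneg (by simp) _
  · intro x; exact Set.indicator_nonneg (by simp) _
  · intro x; exact Set.indicator_le_self' (f := fun _ => (1:ℝ)) (by simp) x

lemma ev_ind (B : Set ℝ) (hB : B.OrdConnected) :
    eVariationOn (B.indicator (fun _ => (1:ℝ))) Set.univ ≤ 2 := by
  set U : Set ℝ := {y | ∃ x ∈ B, x ≤ y}
  have hU : IsUpperSet U := by
    rintro a b hab ⟨x, hx, hxa⟩
    exact ⟨x, hx, hxa.trans hab⟩
  have hV : IsUpperSet (U \ B) := by
    rintro a b hab ⟨⟨x, hx, hxa⟩, h2⟩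
    exact ⟨⟨x, hx, hxa.trans hab⟩, fun hb => h2 (hB.out hx hb ⟨hxa, hab⟩)⟩
  have h1 := ind_mono U hU
  have h2 := ind_mono _ hV
  have key : ∀ x y, edist (B.indicator (fun _ => (1:ℝ)) x) (B.indicator (fun _ => (1:ℝ)) y) ≤
     edist (U.indicator (fun _ => (1:ℝ)) x) (U.indicator (fun _ => (1:ℝ)) y) +
     edist ((U \ B).indicator (fun _ => (1:ℝ)) x) ((U \ B).indicator (fun _ => (1:ℝ)) y) := by
    have hd : B.indicator (fun _ => (1:ℝ)) = fun x => U.indicator (fun _ => (1:ℝ)) x -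
      (U \ B).indicator (fun _ => (1:ℝ)) x := by
      funext x
      by_cases hx : x ∈ B
      · have : x ∈ U := ⟨x, hx, le_rfl⟩
        simp [hx, this]
      · by_cases hxU : x ∈ U <;> simp [hx, hxU]
    intro x y
    rw [hd]
    simp only [edist_dist, Real.dist_eq]
    rw [← ENNReal.ofReal_add (abs_nonneg _) (abs_nonneg _)]
    apply ENNReal.ofReal_le_ofReal
    refine le_trans (le_of_eq ?_) (abs_sub _ _)
    congr 1; ring
  refine iSup_le fun p => ?_
  calc _ ≤ _ := Finset.sum_le_sum fun i _ => key _ _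
    _ = _ := Finset.sum_add_distrib
    _ ≤ 1 + 1 := add_le_add ((eVariationOn.sum_le p.2.2.1 (fun i => Set.mem_univ _)).trans h1)
        ((eVariationOn.sum_le p.2.2.1 (fun i => Set.mem_univ _)).trans h2)
    _ = 2 := one_add_one_eq_two

lemma decay {μ : Measure ℝ} [IsProbabilityMeasure μ] {T : ℝ → ℝ}
    {C τ : ℝ} (hC : 0 < C)
    (hdec : ∀ (n : ℕ) (f g : ℝ → ℝ), Integrable f μ → BoundedVariationOn g Set.univ →
      |(∫ x, f (T^[n] x) * g x ∂μ) - (∫ x, f x ∂μ) * ∫ x, g x ∂μ| ≤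
        C * Real.exp (-τ * n) * (∫ x, |f x| ∂μ) *
          ((⨆ x, |g x|) + (eVariationOn g Set.univ).toReal))
    (B : Set ℝ) (hB : B.OrdConnected) (L : ℕ) (f : ℝ → ℝ) (hf : Integrable f μ) (h0 : ∀ x, 0 ≤ f x) :
    |(∫ x, f (T^[L] x) * B.indicator (fun _ => (1:ℝ)) x ∂μ) - (∫ x, f x ∂μ) * μ.real B| ≤
      3 * C * Real.exp (-τ * L) * ∫ x, f x ∂μ := by
  have hv := ev_ind B hB
  have h := hdec L f (B.indicator (fun _ => (1:ℝ))) hf (ne_top_of_le_ne_top (by simp) hv)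
  rw [integral_indicator_const _ hB.measurableSet] at h
  simp only [smul_eq_mul, mul_one] at h
  have e : ∀ x, |f x| = f x := fun x => abs_of_nonneg (h0 x)
  simp only [e] at h
  refine h.trans ?_
  have hs : (⨆ x, |B.indicator (fun _ => (1:ℝ)) x|) ≤ 1 := by
    refine ciSup_le fun x => ?_
    by_cases hx : x ∈ B <;> simp [hx]
  have hv' : (eVariationOn (B.indicator (fun _ => (1:ℝ))) Set.univ).toReal ≤ 2 := by
    exact ENNReal.toReal_le_of_le_ofReal (by norm_num) (by simpa using hv)
  have hi : 0 ≤ ∫ x, f x ∂μ := integral_nonneg h0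
  calc _ ≤ C * Real.exp (-τ * L) * (∫ x, f x ∂μ) * 3 := by
        apply mul_le_mul_of_nonneg_left (by linarith)
        positivity
    _ = _ := by ring

/-- The sum of the indicator of `B` along the orbit with steps of length `L`. -/
noncomputable def bs (T : ℝ → ℝ) (B : Set ℝ) (L q : ℕ) (x : ℝ) : ℝ :=
  ∑ i ∈ Finset.range q, B.indicator (fun _ => (1:ℝ)) (T^[L * i] x)

lemma ind_nonneg (B : Set ℝ) (x : ℝ) : 0 ≤ B.indicator (fun _ => (1:ℝ)) x :=
  Set.indicator_nonneg (by simp) _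

lemma ind_le (B : Set ℝ) (x : ℝ) : B.indicator (fun _ => (1:ℝ)) x ≤ 1 :=
  Set.indicator_le_self' (f := fun _ => (1:ℝ)) (by simp) x

lemma bs_meas {T : ℝ → ℝ} (hT : Measurable T) {B : Set ℝ} (hB : MeasurableSet B) (L q : ℕ) :
    Measurable (bs T B L q) := by
  unfold bs
  refine Finset.measurable_sum _ fun i _ => ?_
  exact (measurable_const.indicator hB).comp (hT.iterate _)

lemma bs_nonneg (T : ℝ → ℝ) (B : Set ℝ) (L q : ℕ) (x : ℝ) : 0 ≤ bs T B L q x :=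
  Finset.sum_nonneg fun _ _ => ind_nonneg _ _

lemma bs_le (T : ℝ → ℝ) (B : Set ℝ) (L q : ℕ) (x : ℝ) : bs T B L q x ≤ q := by
  have := Finset.sum_le_sum (s := Finset.range q) (fun i _ => ind_le B (T^[L * i] x))
  simpa [bs] using this

lemma bs_int {μ : Measure ℝ} [IsProbabilityMeasure μ] {T : ℝ → ℝ} (hT : Measurable T) {B : Set ℝ}
    (hB : MeasurableSet B) (L q : ℕ) (t : ℝ) :
    Integrable (fun x => Real.exp (t * bs T B L q x)) μ := by
  refine Integrable.of_bound (C := Real.exp (|t| * q))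
    (Real.measurable_exp.comp ((bs_meas hT hB L q).const_mul t)).aestronglyMeasurable ?_
  refine Eventually.of_forall fun x => ?_
  rw [Real.norm_eq_abs, Real.abs_exp, Real.exp_le_exp]
  calc t * bs T B L q x ≤ |t| * bs T B L q x :=
        mul_le_mul_of_nonneg_right (le_abs_self t) (bs_nonneg _ _ _ _ _)
    _ ≤ _ := mul_le_mul_of_nonneg_left (bs_le _ _ _ _ _) (abs_nonneg t)

lemma bs_succ (T : ℝ → ℝ) (B : Set ℝ) (L q : ℕ) (x : ℝ) :
    bs T B L (q+1) x = bs T B L q (T^[L] x) + B.indicator (fun _ => (1:ℝ)) x := by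
  unfold bs
  rw [Finset.sum_range_succ']
  simp only [mul_add, mul_one, Function.iterate_add_apply, mul_zero, Function.iterate_zero, id]

lemma mgf_bs {μ : Measure ℝ} [IsProbabilityMeasure μ] {T : ℝ → ℝ} (hT : MeasurePreserving T μ μ)
    {B : Set ℝ} (hB : MeasurableSet B) (L : ℕ) (κ t : ℝ)
    (hd : ∀ f : ℝ → ℝ, Integrable f μ → (∀ x, 0 ≤ f x) →
      |(∫ x, f (T^[L] x) * B.indicator (fun _ => (1:ℝ)) x ∂μ) - (∫ x, f x ∂μ) * μ.real B| ≤
      κ * ∫ x, f x ∂μ) (hκ : 0 ≤ κ) (ht : |Real.exp t - 1| ≤ 1) (q : ℕ) :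
    ∫ x, Real.exp (t * bs T B L q x) ∂μ ≤
      Real.exp (q * ((Real.exp t - 1) * μ.real B + κ)) := by
  induction q with
  | zero => simp [bs]
  | succ q ih =>
    set f : ℝ → ℝ := fun x => Real.exp (t * bs T B L q x) with hf
    have hfi : Integrable f μ := bs_int hT.measurable hB L q t
    have hTL := hT.iterate L
    have hfi' : Integrable (fun x => f (T^[L] x)) μ := hTL.integrable_comp_of_integrable hfi
    have hfe : ∫ x, f (T^[L] x) ∂μ = ∫ x, f x ∂μ := by
      have := integral_map (μ := μ) (φ := T^[L]) hTL.measurable.aemeasurable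
        (f := f) (by rw [hTL.map_eq]; exact hfi.aestronglyMeasurable)
      rw [hTL.map_eq] at this
      exact this.symm
    have hI : Integrable (fun x => f (T^[L] x) * B.indicator (fun _ => (1:ℝ)) x) μ := by
      refine hfi'.mul_bdd (c := 1) (measurable_const.indicator hB).aestronglyMeasurable ?_
      refine Eventually.of_forall fun x => ?_
      rw [Real.norm_eq_abs, abs_of_nonneg (ind_nonneg _ _)]
      exact ind_le _ _
    have e : ∀ x, Real.exp (t * bs T B L (q+1) x) =
        f (T^[L] x) + (Real.exp t - 1) * (f (T^[L] x) * B.indicator (fun _ => (1:ℝ)) x) := by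
      intro x
      rw [bs_succ, mul_add, Real.exp_add]
      by_cases hx : x ∈ B <;> simp [hx, hf] <;> ring
    simp only [e]
    rw [integral_add hfi' (hI.const_mul _), integral_const_mul, hfe]
    have h0 : 0 ≤ ∫ x, f x ∂μ := integral_nonneg fun x => (Real.exp_pos _).le
    have h := hd f hfi (fun x => (Real.exp_pos _).le)
    set J := ∫ x, f (T^[L] x) * B.indicator (fun _ => (1:ℝ)) x ∂μ
    set W := ∫ x, f x ∂μ
    have h1 : (Real.exp t - 1) * (J - W * μ.real B) ≤ κ * W := by
      calc _ ≤ |(Real.exp t - 1) * (J - W * μ.real B)| := le_abs_self _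
        _ = |Real.exp t - 1| * |J - W * μ.real B| := abs_mul _ _
        _ ≤ 1 * (κ * W) := mul_le_mul ht h (abs_nonneg _) zero_le_one
        _ = _ := one_mul _
    set a := (Real.exp t - 1) * μ.real B + κ with ha
    calc W + (Real.exp t - 1) * J ≤ W * (a + 1) := by rw [ha]; linarith
      _ ≤ W * Real.exp a := mul_le_mul_of_nonneg_left (Real.add_one_le_exp a) h0
      _ ≤ Real.exp (q * a) * Real.exp a := mul_le_mul_of_nonneg_right ih (Real.exp_pos _).le
      _ = _ := by rw [← Real.exp_add]; congr 1; push_cast; ring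

lemma bs_block (T : ℝ → ℝ) (B : Set ℝ) (L q : ℕ) (x : ℝ) :
    bs T B 1 (L * q) x = ∑ r ∈ Finset.range L, bs T B L q (T^[r] x) := by
  induction q with
  | zero => simp [bs]
  | succ q ih =>
    rw [mul_add, mul_one]
    have : bs T B 1 (L * q + L) x = bs T B 1 (L * q) x +
      ∑ r ∈ Finset.range L, B.indicator (fun _ => (1:ℝ)) (T^[L * q + r] x) := by
      unfold bs
      rw [Finset.sum_range_add]; simp
    rw [this, ih, ← Finset.sum_add_distrib]
    refine Finset.sum_congr rfl fun r _ => ?_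
    unfold bs
    rw [Finset.sum_range_succ, Function.iterate_add_apply]

lemma mgf_full {μ : Measure ℝ} [IsProbabilityMeasure μ] {T : ℝ → ℝ} (hT : MeasurePreserving T μ μ)
    {B : Set ℝ} (hB : MeasurableSet B) (L : ℕ) (hL : 0 < L) (κ t : ℝ)
    (hd : ∀ f : ℝ → ℝ, Integrable f μ → (∀ x, 0 ≤ f x) →
      |(∫ x, f (T^[L] x) * B.indicator (fun _ => (1:ℝ)) x ∂μ) - (∫ x, f x ∂μ) * μ.real B| ≤
      κ * ∫ x, f x ∂μ) (hκ : 0 ≤ κ) (ht : |Real.exp t - 1| ≤ 1) (N : ℕ) :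
    ∫ x, Real.exp (t / L * bs T B 1 N x) ∂μ ≤
      Real.exp |t| * Real.exp ((N / L : ℕ) * ((Real.exp t - 1) * μ.real B + κ)) := by
  set q := N / L with hq
  have hL' : (0:ℝ) < L := by exact_mod_cast hL
  have hsplit : ∀ x, t / L * bs T B 1 N x ≤ |t| +
      ∑ r ∈ Finset.range L, (1 / L : ℝ) * (t * bs T B L q (T^[r] x)) := by
    intro x
    have h1 : bs T B 1 N x = bs T B 1 (L * q) x +
        ∑ r ∈ Finset.range (N % L), B.indicator (fun _ => (1:ℝ)) (T^[L * q + r] x) := by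
      conv_lhs => rw [← Nat.div_add_mod N L, ← hq]
      unfold bs
      rw [Finset.sum_range_add]; simp
    set R := ∑ r ∈ Finset.range (N % L), B.indicator (fun _ => (1:ℝ)) (T^[L * q + r] x)
    have hR0 : 0 ≤ R := Finset.sum_nonneg fun _ _ => ind_nonneg _ _
    have hR1 : R ≤ L := by
      have := Finset.sum_le_sum (s := Finset.range (N % L)) (fun r _ => ind_le B (T^[L * q + r] x))
      simp only [Finset.sum_const, Finset.card_range, nsmul_eq_mul, mul_one] at this
      refine this.trans ?_
      exact_mod_cast (Nat.mod_lt N hL).le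
    rw [h1, bs_block, ← Finset.mul_sum, ← Finset.mul_sum, mul_add]
    have : t / L * R ≤ |t| := by
      rw [div_mul_eq_mul_div, div_le_iff₀ hL']
      exact (mul_le_mul_of_nonneg_right (le_abs_self t) hR0).trans
        (mul_le_mul_of_nonneg_left hR1 (abs_nonneg t))
    have e : t / L * ∑ r ∈ Finset.range L, bs T B L q (T^[r] x) =
      1 / L * (t * ∑ r ∈ Finset.range L, bs T B L q (T^[r] x)) := by ring
    linarith
  have hJ : ∀ x, Real.exp (t / L * bs T B 1 N x) ≤ Real.exp |t| *
      ∑ r ∈ Finset.range L, (1 / L : ℝ) * Real.exp (t * bs T B L q (T^[r] x)) := by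
    intro x
    refine (Real.exp_le_exp.2 (hsplit x)).trans ?_
    rw [Real.exp_add]
    refine mul_le_mul_of_nonneg_left ?_ (Real.exp_pos _).le
    have := convexOn_exp.map_sum_le (t := Finset.range L) (w := fun _ => (1 / L : ℝ))
      (p := fun r => t * bs T B L q (T^[r] x)) (fun _ _ => by positivity)
      (by simp [hL'.ne']) (fun _ _ => Set.mem_univ _)
    simpa only [smul_eq_mul] using this
  have hfi : Integrable (fun x => Real.exp (t * bs T B L q x)) μ := bs_int hT.measurable hB L q t
  have hfr : ∀ r, Integrable (fun x => Real.exp (t * bs T B L q (T^[r] x))) μ := fun r =>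
    (hT.iterate r).integrable_comp_of_integrable hfi
  have hfe : ∀ r, ∫ x, Real.exp (t * bs T B L q (T^[r] x)) ∂μ =
      ∫ x, Real.exp (t * bs T B L q x) ∂μ := by
    intro r
    have hTL := hT.iterate r
    have := integral_map (μ := μ) (φ := T^[r]) hTL.measurable.aemeasurable
      (f := fun x => Real.exp (t * bs T B L q x)) (by rw [hTL.map_eq]; exact hfi.aestronglyMeasurable)
    rw [hTL.map_eq] at this
    exact this.symm
  have hs : Integrable (fun x => ∑ r ∈ Finset.range L,
      (1 / L : ℝ) * Real.exp (t * bs T B L q (T^[r] x))) μ :=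
    integrable_finset_sum _ fun r _ => (hfr r).const_mul _
  calc _ ≤ ∫ x, Real.exp |t| *
      ∑ r ∈ Finset.range L, (1 / L : ℝ) * Real.exp (t * bs T B L q (T^[r] x)) ∂μ :=
        integral_mono (bs_int hT.measurable hB 1 N _) (hs.const_mul _) hJ
    _ = Real.exp |t| * ∫ x, Real.exp (t * bs T B L q x) ∂μ := by
        rw [integral_const_mul, integral_finset_sum _ fun r _ => (hfr r).const_mul _]
        simp only [integral_const_mul, hfe]
        simp [hL'.ne']
    _ ≤ _ := mul_le_mul_of_nonneg_left (mgf_bs hT hB L κ t hd hκ ht q) (Real.exp_pos _).le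

lemma mgf_final {μ : Measure ℝ} [IsProbabilityMeasure μ] {T : ℝ → ℝ} (hT : MeasurePreserving T μ μ)
    {B : Set ℝ} (hB : MeasurableSet B) (L : ℕ) (hL : 0 < L) (κ t δ : ℝ)
    (hd : ∀ f : ℝ → ℝ, Integrable f μ → (∀ x, 0 ≤ f x) →
      |(∫ x, f (T^[L] x) * B.indicator (fun _ => (1:ℝ)) x ∂μ) - (∫ x, f x ∂μ) * μ.real B| ≤
      κ * ∫ x, f x ∂μ) (hκ : 0 ≤ κ) (hδ0 : 0 < δ) (hδ1 : δ ≤ 1) (ht : |t| = δ / 2)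
    (hκb : κ ≤ μ.real B * δ ^ 2 / 8) (N : ℕ) :
    ∫ x, Real.exp (t / L * bs T B 1 N x) ∂μ ≤
      Real.exp (2 + N / L * μ.real B * (t + 3 * δ ^ 2 / 8)) := by
  have hL' : (0:ℝ) < L := by exact_mod_cast hL
  have hb0 : 0 ≤ μ.real B := measureReal_nonneg
  have hb1 : μ.real B ≤ 1 := measureReal_le_one
  have hE := Real.abs_exp_sub_one_sub_id_le (x := t) (by rw [ht]; linarith)
  have ht2 : t ^ 2 = δ ^ 2 / 4 := by rw [← sq_abs, ht]; ring
  rw [ht2] at hE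
  have hδ2 : δ ^ 2 ≤ δ := by nlinarith
  obtain ⟨hE1, hE2⟩ := abs_le.1 hE
  obtain ⟨ht1', ht2'⟩ := abs_le.1 ht.le
  have hexp : |Real.exp t - 1| ≤ 1 := by rw [abs_le]; constructor <;> linarith
  refine (mgf_full hT hB L hL κ t hd hκ hexp N).trans ?_
  rw [← Real.exp_add, Real.exp_le_exp, ht]
  set b := μ.real B
  set a := b * (t + 3 * δ ^ 2 / 8) with ha
  have ha1 : (Real.exp t - 1) * b + κ ≤ a := by nlinarith
  have hq1 : ((N / L : ℕ) : ℝ) ≤ N / L := Nat.cast_div_le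
  have hq2 : (N : ℝ) / L - 1 ≤ ((N / L : ℕ) : ℝ) := by
    rw [sub_le_iff_le_add, div_le_iff₀ hL']
    have := Nat.lt_mul_div_succ N hL
    have h2 : (N:ℝ) < L * ((N / L : ℕ) + 1) := by exact_mod_cast this
    linarith
  have habs : |a| ≤ 1 := by
    rw [ha, abs_mul, abs_of_nonneg hb0]
    have : |t + 3 * δ ^ 2 / 8| ≤ 1 := by rw [abs_le]; constructor <;> nlinarith
    nlinarith [abs_nonneg (t + 3 * δ ^ 2 / 8)]
  obtain ⟨h3, h4⟩ := abs_le.1 habs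
  have hq0 : (0:ℝ) ≤ ((N / L : ℕ) : ℝ) := Nat.cast_nonneg _
  set q := ((N / L : ℕ) : ℝ)
  have h5 : q * ((Real.exp t - 1) * b + κ) ≤ q * a := mul_le_mul_of_nonneg_left ha1 hq0
  have h6 : q * a ≤ N / L * a + 1 := by nlinarith
  have h7 : (N:ℝ) / L * b * (t + 3 * δ ^ 2 / 8) = N / L * a := by rw [ha]; ring
  rw [h7]
  linarith

lemma tail {μ : Measure ℝ} [IsProbabilityMeasure μ] {T : ℝ → ℝ} (hT : MeasurePreserving T μ μ)
    {B : Set ℝ} (hB : MeasurableSet B) (L : ℕ) (hL : 0 < L) (κ δ : ℝ)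
    (hd : ∀ f : ℝ → ℝ, Integrable f μ → (∀ x, 0 ≤ f x) →
      |(∫ x, f (T^[L] x) * B.indicator (fun _ => (1:ℝ)) x ∂μ) - (∫ x, f x ∂μ) * μ.real B| ≤
      κ * ∫ x, f x ∂μ) (hκ : 0 ≤ κ) (hδ0 : 0 < δ) (hδ1 : δ ≤ 1)
    (hκb : κ ≤ μ.real B * δ ^ 2 / 8) (N : ℕ) :
    μ.real {x | δ * (N * μ.real B) ≤ |bs T B 1 N x - N * μ.real B|} ≤
      2 * Real.exp (2 - N * μ.real B / L * δ ^ 2 / 8) := by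
  have hL' : (0:ℝ) < L := by exact_mod_cast hL
  set b := μ.real B
  have hsub : {x | δ * (N * b) ≤ |bs T B 1 N x - N * b|} ⊆
      {x | (1 + δ) * (N * b) ≤ bs T B 1 N x} ∪ {x | bs T B 1 N x ≤ (1 - δ) * (N * b)} := by
    intro x hx
    simp only [Set.mem_setOf_eq, Set.mem_union] at hx ⊢
    rcases le_abs.1 hx with h | h
    · left; linarith
    · right; linarith
  have h1 := ProbabilityTheory.measure_ge_le_exp_mul_mgf (μ := μ) (X := bs T B 1 N)
    (t := (δ / 2) / L) ((1 + δ) * (N * b)) (by positivity) (bs_int hT.measurable hB 1 N _)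
  have h2 := ProbabilityTheory.measure_le_le_exp_mul_mgf (μ := μ) (X := bs T B 1 N)
    (t := (-(δ / 2)) / L) ((1 - δ) * (N * b))
    (div_nonpos_of_nonpos_of_nonneg (by linarith) hL'.le) (bs_int hT.measurable hB 1 N _)
  have g1 := mgf_final hT hB L hL κ (δ/2) δ hd hκ hδ0 hδ1 (abs_of_pos (by linarith)) hκb N
  have g2 := mgf_final hT hB L hL κ (-(δ/2)) δ hd hκ hδ0 hδ1
    (by rw [abs_neg, abs_of_pos (by linarith)]) hκb N
  unfold ProbabilityTheory.mgf at h1 h2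
  have k1 := h1.trans (mul_le_mul_of_nonneg_left g1 (Real.exp_pos _).le)
  have k2 := h2.trans (mul_le_mul_of_nonneg_left g2 (Real.exp_pos _).le)
  rw [← Real.exp_add] at k1 k2
  have e1 : -(δ / 2 / L) * ((1 + δ) * (N * b)) + (2 + N / L * b * (δ / 2 + 3 * δ ^ 2 / 8))
    = 2 - N * b / L * δ ^ 2 / 8 := by field_simp; ring
  have e2 : -(-(δ / 2) / L) * ((1 - δ) * (N * b)) + (2 + N / L * b * (-(δ / 2) + 3 * δ ^ 2 / 8))
    = 2 - N * b / L * δ ^ 2 / 8 := by field_simp; ring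
  change _ ≤ Real.exp (-(δ / 2 / L) * ((1 + δ) * (N * b)) + (2 + N / L * b * (δ / 2 + 3 * δ ^ 2 / 8))) at k1
  change _ ≤ Real.exp (-(-(δ / 2) / L) * ((1 - δ) * (N * b)) + (2 + N / L * b * (-(δ / 2) + 3 * δ ^ 2 / 8))) at k2
  rw [e1] at k1
  rw [e2] at k2
  refine (measureReal_mono hsub).trans ((measureReal_union_le _ _).trans ?_)
  linarith

lemma M_asym (a : ℝ) (ha : 1 < a) (M : ℕ → ℕ) (hM : ∀ n, M n = ⌈(n : ℝ) ^ a⌉₊) :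
    Tendsto (fun n : ℕ => (n : ℝ) * ((M (n+1) : ℝ) - M n) / M n) atTop (nhds a) := by
  have hpow : Tendsto (fun n : ℕ => (n : ℝ) ^ a) atTop atTop :=
    (tendsto_rpow_atTop (by linarith)).comp tendsto_natCast_atTop_atTop
  have hr : Tendsto (fun n : ℕ => (M n : ℝ) / (n : ℝ) ^ a) atTop (nhds 1) := by
    simp only [hM]
    exact (tendsto_nat_ceil_div_atTop (R := ℝ)).comp hpow
  have hder : HasDerivAt (fun x : ℝ => x ^ a) a 1 := by
    simpa using Real.hasDerivAt_rpow_const (x := 1) (p := a) (Or.inl one_ne_zero)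
  rw [hasDerivAt_iff_tendsto_slope_zero] at hder
  have hinv : Tendsto (fun n : ℕ => ((n : ℝ))⁻¹) atTop (nhdsWithin 0 {0}ᶜ) := by
    refine tendsto_nhdsWithin_iff.2 ⟨tendsto_inv_atTop_nhds_zero_nat, ?_⟩
    filter_upwards [eventually_gt_atTop 0] with n hn
    have : (n:ℝ) ≠ 0 := by positivity
    simpa using hn.ne'
  have h1 := hder.comp hinv
  have h2 : Tendsto (fun n : ℕ => (n : ℝ) * (((M (n+1) : ℝ) - ((n+1 : ℕ) : ℝ) ^ a) -
      (M n - (n : ℝ) ^ a)) / (n : ℝ) ^ a) atTop (nhds 0) := by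
    have h3 : Tendsto (fun n : ℕ => (n : ℝ) ^ (-(a - 1))) atTop (nhds 0) :=
      (tendsto_rpow_neg_atTop (by linarith)).comp tendsto_natCast_atTop_atTop
    refine squeeze_zero_norm' ?_ h3
    filter_upwards [eventually_gt_atTop 0] with n hn
    have hn' : (0:ℝ) < n := by exact_mod_cast hn
    have e : ∀ k, 0 ≤ (M k : ℝ) - (k : ℝ) ^ a ∧ (M k : ℝ) - (k : ℝ) ^ a ≤ 1 := by
      intro k
      rw [hM]
      constructor
      · linarith [Nat.le_ceil ((k : ℝ) ^ a)]
      · linarith [Nat.ceil_lt_add_one (a := (k : ℝ) ^ a) (by positivity)]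
    have hab : |((M (n+1) : ℝ) - ((n+1 : ℕ) : ℝ) ^ a) - (M n - (n : ℝ) ^ a)| ≤ 1 := by
      have := e n; have := e (n+1)
      rw [abs_le]; constructor <;> linarith
    have hpa : (n:ℝ) ^ (-(a - 1)) = n / (n:ℝ) ^ a := by
      rw [neg_sub, Real.rpow_sub hn', Real.rpow_one]
    rw [hpa, norm_div, norm_mul, Real.norm_eq_abs, Real.norm_eq_abs, Real.norm_eq_abs,
      abs_of_pos hn', abs_of_pos (Real.rpow_pos_of_pos hn' a)]
    gcongr
    nlinarith
  have h4 := (h1.add h2).div hr one_ne_zero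
  simp only [add_zero, div_one] at h4
  refine h4.congr' ?_
  filter_upwards [eventually_gt_atTop 0] with n hn
  have hn' : (0:ℝ) < n := by exact_mod_cast hn
  have hp : (0:ℝ) < (n:ℝ) ^ a := Real.rpow_pos_of_pos hn' a
  have e1 : (1 + (n:ℝ)⁻¹) ^ a = ((n+1 : ℕ) : ℝ) ^ a / (n:ℝ) ^ a := by
    rw [← Real.div_rpow (by positivity) hn'.le]
    congr 1
    push_cast; field_simp
  have hM0 : (0:ℝ) < M n := lt_of_lt_of_le hp (by rw [hM]; exact Nat.le_ceil _)
  simp only [Pi.div_apply, Function.comp, Real.one_rpow, smul_eq_mul, inv_inv, e1]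
  field_simp
  ring

lemma ncard_bs (T : ℝ → ℝ) (B : Set ℝ) (m m' : ℕ) (x : ℝ) :
    ({k : ℕ | m ≤ k ∧ k < m' ∧ T^[k] x ∈ B}.ncard : ℝ) = bs T B 1 (m' - m) (T^[m] x) := by
  classical
  have : {k : ℕ | m ≤ k ∧ k < m' ∧ T^[k] x ∈ B} =
      ((Finset.Ico m m').filter fun k => T^[k] x ∈ B : Finset ℕ) := by
    ext k; simp [and_assoc]
  rw [this, Set.ncard_coe_finset, Finset.card_filter, Finset.sum_Ico_eq_sum_range]
  unfold bs
  push_cast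
  refine Finset.sum_congr rfl fun i _ => ?_
  rw [one_mul, ← Function.iterate_add_apply, add_comm i m]
  simp [Set.indicator_apply]

lemma sqrt_lim (s c : ℝ) (hc : 0 < c) :
    Tendsto (fun n : ℕ => (n:ℝ) ^ s * Real.exp (-c * √(n:ℝ))) atTop (nhds 0) := by
  have h := (tendsto_rpow_mul_exp_neg_mul_atTop_nhds_zero (2 * s) c hc).comp
    (Real.tendsto_sqrt_atTop.comp tendsto_natCast_atTop_atTop)
  refine h.congr fun n => ?_
  simp only [Function.comp]
  congr 1
  rw [Real.rpow_mul (Real.sqrt_nonneg _)]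
  congr 1
  rw [Real.rpow_two, Real.sq_sqrt (Nat.cast_nonneg n)]

theorem stmt8
    (μ : Measure ℝ) [IsProbabilityMeasure μ] (T : ℝ → ℝ)
    (hT : MeasurePreserving T μ μ)
    (C τ : ℝ) (hC : 0 < C) (hτ : 0 < τ)
    (hdec : ∀ (n : ℕ) (f g : ℝ → ℝ), Integrable f μ → BoundedVariationOn g Set.univ →
      |(∫ x, f (T^[n] x) * g x ∂μ) - (∫ x, f x ∂μ) * ∫ x, g x ∂μ| ≤
        C * Real.exp (-τ * n) * (∫ x, |f x| ∂μ) *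
          ((⨆ x, |g x|) + (eVariationOn g Set.univ).toReal))
    (ε : ℝ) (hε : ε ∈ Set.Ioo (0 : ℝ) 1)
    (B : ℕ → Set ℝ) (hBint : ∀ m, (B m).OrdConnected)
    (hB : ∀ m : ℕ, 1 ≤ m → (m : ℝ) ^ (-1 + ε) ≤ (μ (B m)).toReal)
    (M : ℕ → ℕ) (hM : ∀ n, M n = ⌈(n : ℝ) ^ (2 / ε)⌉₊) :
    ∀ᵐ x ∂μ,
      Tendsto (fun n : ℕ =>
          (n : ℝ) * ({k : ℕ | M n ≤ k ∧ k < M (n + 1) ∧ T^[k] x ∈ B (M n)}.ncard : ℝ) /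
            ((M n : ℝ) * (μ (B (M n))).toReal))
        atTop (nhds (2 / ε)) ∧
      Tendsto (fun n : ℕ =>
          ({k : ℕ | M n ≤ k ∧ k < M (n + 1) ∧ T^[k] x ∈ B (M n)}.ncard : ℝ) /
            ((M n : ℝ) * (μ (B (M n))).toReal))
        atTop (nhds 0) := by
  obtain ⟨hε0, hε1⟩ := hε
  set a := 2 / ε with ha
  have ha1 : 1 < a := by rw [ha, lt_div_iff₀ hε0]; linarith
  have haε : a * ε = 2 := by rw [ha]; field_simp
  have hlim := M_asym a ha1 M hM
  simp only [ncard_bs]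
  have hmono : ∀ n, M n ≤ M (n+1) := by
    intro n
    rw [hM, hM]
    apply Nat.ceil_mono
    apply Real.rpow_le_rpow (by positivity) (by push_cast; linarith) (by linarith)
  set N : ℕ → ℕ := fun n => M (n+1) - M n with hN
  have hNc : ∀ n, (N n : ℝ) = (M (n+1) : ℝ) - M n := fun n => by
    rw [hN]; exact Nat.cast_sub (hmono n)
  set b : ℕ → ℝ := fun n => μ.real (B (M n)) with hb
  have hbdef : ∀ n, (μ (B (M n))).toReal = b n := fun n => rfl
  have hMn : ∀ n : ℕ, (n:ℝ) ^ a ≤ M n := fun n => by rw [hM]; exact Nat.le_ceil _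
  have hM1 : ∀ n, 1 ≤ n → 1 ≤ M n := by
    intro n hn
    have h1 : (1:ℝ) ≤ (n:ℝ) ^ a := Real.one_le_rpow (by exact_mod_cast hn) (by linarith)
    exact_mod_cast h1.trans (hMn n)
  have hbM : ∀ n, 1 ≤ n → 1 ≤ b n * M n := by
    intro n hn
    have h1 := hB (M n) (hM1 n hn)
    rw [hbdef] at h1
    have h0 : (1:ℝ) ≤ M n := by exact_mod_cast hM1 n hn
    have h2 : (M n : ℝ) ^ (-1 : ℝ) ≤ (M n : ℝ) ^ (-1 + ε) :=
      Real.rpow_le_rpow_of_exponent_le h0 (by linarith)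
    rw [Real.rpow_neg_one] at h2
    have h3 := h2.trans h1
    rwa [inv_le_iff_one_le_mul₀ (by linarith)] at h3
  have hbn : ∀ n : ℕ, 1 ≤ n → (n:ℝ) ^ 2 ≤ M n * b n := by
    intro n hn
    have h1 := hB (M n) (hM1 n hn)
    rw [hbdef] at h1
    have h0 : (1:ℝ) ≤ M n := by exact_mod_cast hM1 n hn
    calc (n:ℝ) ^ 2 = ((n:ℝ) ^ a) ^ ε := by
          rw [← Real.rpow_mul (by positivity), haε, Real.rpow_two]
      _ ≤ (M n : ℝ) ^ ε := Real.rpow_le_rpow (by positivity) (hMn n) hε0.le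
      _ = M n * (M n : ℝ) ^ (-1 + ε) := by
          rw [Real.rpow_add (by linarith), Real.rpow_neg_one]; field_simp
      _ ≤ _ := by gcongr
  have hNb : ∀ᶠ n : ℕ in atTop, (n:ℝ) ≤ N n * b n := by
    filter_upwards [hlim.eventually (lt_mem_nhds ha1), eventually_ge_atTop 1] with n h1 hn
    have hn' : (0:ℝ) < n := by exact_mod_cast hn
    have h0 : (0:ℝ) < M n := by exact_mod_cast hM1 n hn
    rw [← hNc, lt_div_iff₀ h0, one_mul] at h1
    have h2 := hbn n hn
    have hb0 : 0 ≤ b n := measureReal_nonneg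
    have h3 : (n:ℝ) * n ≤ n * (N n * b n) := by
      calc (n:ℝ) * n = n ^ 2 := by ring
        _ ≤ M n * b n := h2
        _ ≤ (n * N n) * b n := by gcongr
        _ = _ := by ring
    exact le_of_mul_le_mul_left h3 hn'
  -- Borel-Cantelli
  have key : ∀ p : ℕ, ∀ᵐ x ∂μ, ∀ᶠ n in atTop,
      |bs T (B (M n)) 1 (N n) (T^[M n] x) - N n * b n| < 1 / ((p:ℝ) + 1) * (N n * b n) := by
    intro p
    set δ : ℝ := 1 / ((p:ℝ) + 1) with hδ
    have hδ0 : 0 < δ := by positivity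
    have hδ1 : δ ≤ 1 := by rw [hδ, div_le_one (by positivity)]; linarith [Nat.cast_nonneg (α := ℝ) p]
    set E : ℕ → Set ℝ := fun n =>
      {y | δ * (N n * b n) ≤ |bs T (B (M n)) 1 (N n) y - N n * b n|} with hE
    have hEm : ∀ n, MeasurableSet (E n) := fun n =>
      measurableSet_le measurable_const
        (((bs_meas hT.measurable (hBint _).measurableSet 1 (N n)).sub measurable_const).abs)
    set L : ℕ → ℕ := fun n => Nat.sqrt n + 1 with hL
    have hL1 : ∀ n : ℕ, √(n:ℝ) ≤ L n := by
      intro n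
      rw [Real.sqrt_le_left (by positivity)]
      have := Nat.lt_succ_sqrt n
      have h2 : n ≤ (n.sqrt + 1) ^ 2 := by rw [sq]; exact this.le
      exact_mod_cast h2
    have hL2 : ∀ n : ℕ, 1 ≤ n → (L n : ℝ) ≤ 2 * √(n:ℝ) := by
      intro n hn
      have h1 : (1:ℝ) ≤ √(n:ℝ) := by rw [Real.one_le_sqrt]; exact_mod_cast hn
      have h2 : (n.sqrt : ℝ) ≤ √(n:ℝ) := Real.nat_sqrt_le_real_sqrt
      simp only [hL]; push_cast; linarith
    have hκ : ∀ᶠ n in atTop, 3 * C * Real.exp (-τ * L n) ≤ b n * δ ^ 2 / 8 := by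
      have h := (sqrt_lim a τ hτ).eventually (gt_mem_nhds (show (0:ℝ) < δ ^ 2 / (48 * C) by positivity))
      filter_upwards [h, eventually_ge_atTop 1] with n h1 hn
      have h0 : (0:ℝ) < M n := by exact_mod_cast hM1 n hn
      have hpa : (1:ℝ) ≤ (n:ℝ) ^ a := Real.one_le_rpow (by exact_mod_cast hn) (by linarith)
      have hM2 : (M n : ℝ) ≤ 2 * (n:ℝ) ^ a := by
        rw [hM]
        linarith [Nat.ceil_lt_add_one (a := (n : ℝ) ^ a) (by positivity)]
      have he : Real.exp (-τ * L n) ≤ Real.exp (-τ * √(n:ℝ)) := by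
        rw [Real.exp_le_exp]; nlinarith [hL1 n]
      rw [lt_div_iff₀ (by positivity)] at h1
      have h5 : M n * (3 * C * Real.exp (-τ * L n)) ≤ δ ^ 2 / 8 := by
        calc M n * (3 * C * Real.exp (-τ * L n))
            ≤ (2 * (n:ℝ) ^ a) * (3 * C * Real.exp (-τ * √(n:ℝ))) := by gcongr
          _ = ((n:ℝ) ^ a * Real.exp (-τ * √(n:ℝ)) * (48 * C)) / 8 := by ring
          _ ≤ _ := by linarith
      have h6 : M n * (3 * C * Real.exp (-τ * L n)) ≤ M n * (b n * δ ^ 2 / 8) := by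
        refine h5.trans ?_
        have := hbM n hn
        nlinarith [sq_nonneg δ]
      exact le_of_mul_le_mul_left h6 h0
    have htail : ∀ᶠ n in atTop, μ.real (E n) ≤
        2 * Real.exp 2 * Real.exp (-(δ ^ 2 / 16) * √(n:ℝ)) := by
      filter_upwards [hκ, hNb, eventually_ge_atTop 1] with n h1 h2 hn
      have hn' : (0:ℝ) < n := by exact_mod_cast hn
      have hLp : (0:ℝ) < L n := by positivity
      have h3 := tail hT (hBint (M n)).measurableSet (L n) (Nat.succ_pos _)
        (3 * C * Real.exp (-τ * L n)) δ
        (fun f hf h0 => decay hC hdec _ (hBint (M n)) (L n) f hf h0) (by positivity) hδ0 hδ1 h1 (N n)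
      refine h3.trans ?_
      rw [mul_assoc, ← Real.exp_add]
      have h4 : √(n:ℝ) / 2 ≤ N n * b n / L n := by
        rw [le_div_iff₀ hLp]
        calc √(n:ℝ) / 2 * L n ≤ √(n:ℝ) / 2 * (2 * √(n:ℝ)) := by gcongr; exact hL2 n hn
          _ = √(n:ℝ) * √(n:ℝ) := by ring
          _ = n := Real.mul_self_sqrt hn'.le
          _ ≤ _ := h2
      refine mul_le_mul_of_nonneg_left (Real.exp_le_exp.2 ?_) zero_le_two
      change 2 - N n * b n / L n * δ ^ 2 / 8 ≤ _
      nlinarith [sq_nonneg δ]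
    have hsum : Summable fun n => μ.real (E n) := by
      have h := (sqrt_lim 2 (δ ^ 2 / 16) (by positivity)).eventually
        (gt_mem_nhds (show (0:ℝ) < 1 by norm_num))
      refine Summable.of_norm_bounded_eventually_nat
        (g := fun n : ℕ => 2 * Real.exp 2 * (1 / (n:ℝ) ^ 2))
        ((Real.summable_one_div_nat_pow.2 (by norm_num)).mul_left _) ?_
      filter_upwards [h, htail, eventually_ge_atTop 1] with n h1 h2 hn
      have hn' : (0:ℝ) < n := by exact_mod_cast hn
      rw [Real.norm_eq_abs, abs_of_nonneg measureReal_nonneg]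
      refine h2.trans ?_
      refine mul_le_mul_of_nonneg_left ?_ (by positivity)
      rw [le_div_iff₀ (by positivity)]
      rw [Real.rpow_two] at h1
      linarith
    have hfin : ∑' n, μ ((T^[M n]) ⁻¹' E n) ≠ ⊤ := by
      have e : ∀ n, μ ((T^[M n]) ⁻¹' E n) = ENNReal.ofReal (μ.real (E n)) := by
        intro n
        rw [(hT.iterate (M n)).measure_preimage (hEm n).nullMeasurableSet, ofReal_measureReal]
      simp only [e]
      exact hsum.tsum_ofReal_ne_top
    filter_upwards [ae_eventually_notMem hfin] with x hx
    filter_upwards [hx] with n hn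
    simpa [hE] using hn
  filter_upwards [ae_all_iff.2 key] with x hx
  have hratio : Tendsto (fun n => bs T (B (M n)) 1 (N n) (T^[M n] x) / (N n * b n)) atTop (nhds 1) := by
    rw [Metric.tendsto_atTop']
    intro η hη
    obtain ⟨p, hp⟩ := exists_nat_one_div_lt hη
    obtain ⟨n₀, hn₀⟩ := ((hx p).and (hNb.and (eventually_ge_atTop 1))).exists_forall_of_atTop
    refine ⟨n₀, fun n hn => ?_⟩
    obtain ⟨h1, h2, h3⟩ := hn₀ n hn.le
    have hpos : 0 < N n * b n := lt_of_lt_of_le (by exact_mod_cast h3) h2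
    rw [Real.dist_eq, div_sub_one hpos.ne', abs_div, abs_of_pos hpos, div_lt_iff₀ hpos]
    exact h1.trans (mul_lt_mul_of_pos_right hp hpos)
  have hfirst : Tendsto (fun n : ℕ => (n : ℝ) * bs T (B (M n)) 1 (N n) (T^[M n] x) /
      ((M n : ℝ) * b n)) atTop (nhds a) := by
    have := hlim.mul hratio
    rw [mul_one] at this
    refine this.congr' ?_
    filter_upwards [hNb, eventually_ge_atTop 1] with n h2 hn
    have hpos : 0 < N n * b n := lt_of_lt_of_le (by exact_mod_cast hn) h2
    have hN0 : (N n : ℝ) ≠ 0 := left_ne_zero_of_mul hpos.ne'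
    have hb0 : b n ≠ 0 := right_ne_zero_of_mul hpos.ne'
    have h0 : (M n : ℝ) ≠ 0 := by have := hM1 n hn; positivity
    rw [← hNc]
    field_simp
  refine ⟨hfirst, ?_⟩
  have := hfirst.mul (tendsto_inv_atTop_nhds_zero_nat (𝕜 := ℝ))
  rw [mul_zero] at this
  refine this.congr' ?_
  filter_upwards [eventually_ge_atTop 1] with n hn
  have hn' : (n:ℝ) ≠ 0 := by positivity
  rw [hbdef]
  change _ = bs T (B (M n)) 1 (N n) (T^[M n] x) / ((M n : ℝ) * b n)
  field_simp
end
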